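/- arXiv:2104.05056 — 2 statements merged into one kernel-verified Lean document; each statement's English description precedes it below -/
import Mathlib

section
/- Let (Ω, C, Λ) be a naive convex co-compact triple. If sup over x ∈ ∂_i C of diam_{F_Ω(x)}(∂_i C ∩ F_Ω(x)) = +∞, where the diameter is with respect to the Hilbert metric of the face F_Ω(x), then C contains a properly embedded two-dimensional simplex. -/
open Set Filter

noncomputable section

/-- Real projective space `P(ℝ^d)`, with the quotient topology. -/
abbrev PSpace (d : ℕ) := Projectivization ℝ (Fin d → ℝ)

instance PSpace.instTopologicalSpace (d : ℕ) : TopologicalSpace (PSpace d) :=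
  inferInstanceAs (TopologicalSpace (Quotient (projectivizationSetoid ℝ (Fin d → ℝ))))

namespace Paper

variable {d : ℕ}

/-- Inhomogeneous coordinates in the affine chart determined by the linear functional `f`:
a projective point `[v]` with `f v ≠ 0` is sent to the representative `v / f v` lying in the
affine hyperplane `{f = 1}`. -/
def chartMap (f : (Fin d → ℝ) →ₗ[ℝ] ℝ) (x : PSpace d) : Fin d → ℝ :=
  (f x.rep)⁻¹ • x.rep

/-- A subset of `P(ℝ^d)` is properly convex if there is an affine chart in which it is a
bounded convex set. -/
def IsProperlyConvex (C : Set (PSpace d)) : Prop :=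
  ∃ f : (Fin d → ℝ) →ₗ[ℝ] ℝ, (∀ x ∈ closure C, f x.rep ≠ 0) ∧
    Convex ℝ (chartMap f '' C) ∧ Bornology.IsBounded (chartMap f '' C)

/-- A properly convex domain: an open, nonempty, properly convex subset of `P(ℝ^d)`. -/
def IsPCDomain (Ω : Set (PSpace d)) : Prop :=
  IsOpen Ω ∧ Ω.Nonempty ∧ IsProperlyConvex Ω

open Classical in
/-- A choice of an affine chart containing the properly convex set `C`. -/
def chartOf (C : Set (PSpace d)) : (Fin d → ℝ) →ₗ[ℝ] ℝ :=
  if h : IsProperlyConvex C then h.choose else 0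

/-- The chart map associated to the chosen chart of `C`. -/
def cmap (C : Set (PSpace d)) : PSpace d → Fin d → ℝ := chartMap (chartOf C)

/-- The Hilbert distance between `u` and `v` computed in an affine chart where the convex set
is `O`: writing the line through `u, v` as `t ↦ u + t(v-u)`, with boundary parameters
`tm = inf {t | u + t(v-u) ∈ O} ≤ 0` and `tp = sup {...} ≥ 1`, the cross-ratio
`[a,u,v,b]` of `a = u + tm(v-u), u, v, b = u + tp(v-u)` equals `(tp(1-tm))/((-tm)(tp-1))`. -/
def hilbertDistChart (O : Set (Fin d → ℝ)) (u v : Fin d → ℝ) : ℝ :=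
  if u = v then 0
  else
    (1 / 2) * Real.log
      ((sSup {t : ℝ | u + t • (v - u) ∈ O} * (1 - sInf {t : ℝ | u + t • (v - u) ∈ O})) /
        ((-(sInf {t : ℝ | u + t • (v - u) ∈ O})) * (sSup {t : ℝ | u + t • (v - u) ∈ O} - 1)))

/-- The Hilbert metric of a properly convex set `C` (open in its span). -/
def hilbertDist (C : Set (PSpace d)) (x y : PSpace d) : ℝ :=
  hilbertDistChart (cmap C '' C) (cmap C x) (cmap C y)

/-- The closed projective line segment `[x,y]` contained in `closure C`. -/
def projSeg (C : Set (PSpace d)) (x y : PSpace d) : Set (PSpace d) :=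
  {z ∈ closure C | cmap C z ∈ segment ℝ (cmap C x) (cmap C y)}

/-- The open projective line segment `(x,y)` contained in `closure C`. -/
def projOpenSeg (C : Set (PSpace d)) (x y : PSpace d) : Set (PSpace d) :=
  {z ∈ closure C | cmap C z ∈ openSegment ℝ (cmap C x) (cmap C y)}

/-- The open face `F_C(x)` of a point `x ∈ closure C`: the set `{x}` together with all
`y ∈ closure C` such that some open line segment contained in `closure C` contains
both `x` and `y`. -/
def face (C : Set (PSpace d)) (x : PSpace d) : Set (PSpace d) :=
  insert x {y ∈ closure C | ∃ a ∈ closure C, ∃ b ∈ closure C,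
    x ∈ projOpenSeg C a b ∧ y ∈ projOpenSeg C a b}

/-- The ideal boundary `∂_i C = closure C \ C`. -/
def idealBdry (C : Set (PSpace d)) : Set (PSpace d) := closure C \ C

/-- The dimension of a subset `B`, computed in the chart of the ambient convex set `C`. -/
def pdimIn (C B : Set (PSpace d)) : ℕ :=
  Module.finrank ℝ (affineSpan ℝ (cmap C '' B)).direction

/-- The dimension of a convex subset of `P(ℝ^d)`. -/
def pdim (A : Set (PSpace d)) : ℕ := pdimIn A A

/-- The coarse dimension `cdim_C(A)` of a nonempty subset `A` of a properly convex set `C`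
open in its span: the smallest `k` such that `A` is contained in an `R`-neighborhood (for the
Hilbert metric of `C`) of a `k`-dimensional convex subset `B ⊆ C`. -/
def cdim (C A : Set (PSpace d)) : ℕ :=
  sInf {k : ℕ | ∃ R : ℝ, 0 < R ∧ ∃ B : Set (PSpace d), B ⊆ C ∧
    Convex ℝ (cmap C '' B) ∧ pdimIn C B = k ∧
    A ⊆ {p ∈ C | ∃ q ∈ B, hilbertDist C p q < R}}

/-- The cone over the standard open `(p-1)`-dimensional simplex: vectors whose first `p`
coordinates are positive and whose remaining coordinates vanish. -/
def simplexCone (p : ℕ) : Set (Fin d → ℝ) :=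
  {v | (∀ i : Fin d, (i : ℕ) < p → 0 < v i) ∧ ∀ i : Fin d, p ≤ (i : ℕ) → v i = 0}

/-- `S` is the image under `g ∈ PGL_d(ℝ)` of the standard open simplex with `p` vertices. -/
def IsSimplexWithMap (p : ℕ) (S : Set (PSpace d)) (g : (Fin d → ℝ) ≃ₗ[ℝ] (Fin d → ℝ)) : Prop :=
  S = {q : PSpace d | ∃ v ∈ simplexCone (d := d) p, ∃ hv : v ≠ 0,
        q = Projectivization.mk ℝ (g v) (by simpa using hv)}

/-- `S ⊆ P(ℝ^d)` is a simplex of dimension `k`. -/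
def IsSimplexOfDim (k : ℕ) (S : Set (PSpace d)) : Prop :=
  k + 1 ≤ d ∧ ∃ g : (Fin d → ℝ) ≃ₗ[ℝ] (Fin d → ℝ), IsSimplexWithMap (k + 1) S g

/-- `S` is a simplex with vertices `v 0, …, v (p-1)` (so of dimension `p - 1`). -/
def HasVertices {p : ℕ} (S : Set (PSpace d)) (v : Fin p → PSpace d) : Prop :=
  ∃ (hp : p ≤ d) (g : (Fin d → ℝ) ≃ₗ[ℝ] (Fin d → ℝ)),
    IsSimplexWithMap p S g ∧
    ∀ j : Fin p, v j = Projectivization.mk ℝ (g (Pi.single (Fin.castLE hp j) 1))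
      (by
        simp only [ne_eq, EmbeddingLike.map_eq_zero_iff]
        intro h
        have h1 := congrFun h (Fin.castLE hp j)
        rw [Pi.single_eq_same] at h1
        exact one_ne_zero (α := ℝ) h1)

/-- `A ⊆ B` is properly embedded if the inclusion map `A ↪ B` is proper. -/
def IsProperlyEmbedded (A B : Set (PSpace d)) : Prop :=
  ∃ h : A ⊆ B, IsProperMap (Set.inclusion h)

/-- The projective action of `GL(ℝ^d)` (hence of `PGL_d(ℝ)`) on `P(ℝ^d)`. -/
def pact (g : (Fin d → ℝ) ≃ₗ[ℝ] (Fin d → ℝ)) : PSpace d → PSpace d :=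
  Projectivization.map g.toLinearMap g.injective

/-- A naive convex co-compact triple `(Ω, C, Λ)`. -/
structure NCCTriple (d : ℕ) where
  Ω : Set (PSpace d)
  C : Set (PSpace d)
  Λ : Subgroup ((Fin d → ℝ) ≃ₗ[ℝ] (Fin d → ℝ))
  isOpen_Ω : IsOpen Ω
  nonempty_Ω : Ω.Nonempty
  properlyConvex_Ω : IsProperlyConvex Ω
  inv_Ω : ∀ g ∈ Λ, pact g '' Ω = Ω
  infinite_Λ : (Λ : Set ((Fin d → ℝ) ≃ₗ[ℝ] (Fin d → ℝ))).Infinite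
  discrete_Λ : ∀ K ⊆ Ω, IsCompact K →
    {g : (Fin d → ℝ) ≃ₗ[ℝ] (Fin d → ℝ) | g ∈ Λ ∧ (pact g '' K ∩ K).Nonempty}.Finite
  C_nonempty : C.Nonempty
  C_sub : C ⊆ Ω
  C_closedInΩ : closure C ∩ Ω ⊆ C
  C_convex : Convex ℝ (cmap Ω '' C)
  inv_C : ∀ g ∈ Λ, pact g '' C = C
  cocompact : ∃ K : Set (PSpace d), K ⊆ C ∧ IsCompact K ∧ C ⊆ ⋃ g ∈ Λ, pact g '' K

/-- The orbit of a point under a subgroup of `PGL_d(ℝ)`. -/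
def porbit (Λ : Subgroup ((Fin d → ℝ) ≃ₗ[ℝ] (Fin d → ℝ))) (p : PSpace d) : Set (PSpace d) :=
  {q | ∃ g ∈ Λ, q = pact g p}

/-- The full orbital limit set `L_Ω(Λ)`. -/
def limitSet (Ω : Set (PSpace d)) (Λ : Subgroup ((Fin d → ℝ) ≃ₗ[ℝ] (Fin d → ℝ))) :
    Set (PSpace d) :=
  ⋃ p ∈ Ω, (closure (porbit Λ p) \ porbit Λ p)

/-- The convex hull of `X ⊆ closure Ω` taken inside `Ω`. -/
def convHullIn (Ω X : Set (PSpace d)) : Set (PSpace d) :=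
  {z ∈ Ω | cmap Ω z ∈ convexHull ℝ (cmap Ω '' X)}

/-- `C_Ω(Λ)`: the convex hull of the full orbital limit set in `Ω`. -/
def coreC (Ω : Set (PSpace d)) (Λ : Subgroup ((Fin d → ℝ) ≃ₗ[ℝ] (Fin d → ℝ))) :
    Set (PSpace d) :=
  convHullIn Ω (limitSet Ω Λ)

/-- A convex co-compact group `Λ ⊆ Aut(Ω)`: an infinite discrete subgroup preserving `Ω`
such that `C_Ω(Λ)` is nonempty and `Λ` acts cocompactly on it. -/
structure CCSetup (d : ℕ) where
  Ω : Set (PSpace d)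
  Λ : Subgroup ((Fin d → ℝ) ≃ₗ[ℝ] (Fin d → ℝ))
  isOpen_Ω : IsOpen Ω
  nonempty_Ω : Ω.Nonempty
  properlyConvex_Ω : IsProperlyConvex Ω
  inv_Ω : ∀ g ∈ Λ, pact g '' Ω = Ω
  infinite_Λ : (Λ : Set ((Fin d → ℝ) ≃ₗ[ℝ] (Fin d → ℝ))).Infinite
  discrete_Λ : ∀ K ⊆ Ω, IsCompact K →
    {g : (Fin d → ℝ) ≃ₗ[ℝ] (Fin d → ℝ) | g ∈ Λ ∧ (pact g '' K ∩ K).Nonempty}.Finite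
  core_nonempty : (coreC Ω Λ).Nonempty
  cocompact : ∃ K : Set (PSpace d), K ⊆ coreC Ω Λ ∧ IsCompact K ∧
    coreC Ω Λ ⊆ ⋃ g ∈ Λ, pact g '' K

/-- The Gromov product of `x, y` at `w`, with respect to the Hilbert metric of `Ω`. -/
def gromovProd (Ω : Set (PSpace d)) (w x y : PSpace d) : ℝ :=
  (hilbertDist Ω x w + hilbertDist Ω y w - hilbertDist Ω x y) / 2

/-- `(C, d_Ω)` is Gromov hyperbolic. -/
def GromovHyperbolicOn (Ω C : Set (PSpace d)) : Prop :=
  ∃ δ : ℝ, 0 ≤ δ ∧ ∀ x ∈ C, ∀ y ∈ C, ∀ z ∈ C, ∀ w ∈ C,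
    min (gromovProd Ω w x y) (gromovProd Ω w y z) - δ ≤ gromovProd Ω w x z

/-- The open Hilbert-metric ball in `Ω`. -/
def hBall (Ω : Set (PSpace d)) (x : PSpace d) (r : ℝ) : Set (PSpace d) :=
  {y ∈ Ω | hilbertDist Ω x y < r}

/-- The Hausdorff distance between `A` and `B` (w.r.t. the Hilbert metric of `Ω`)
is less than `ε`. -/
def hausLT (Ω A B : Set (PSpace d)) (ε : ℝ) : Prop :=
  (∀ a ∈ A, ∃ b ∈ B, hilbertDist Ω a b < ε) ∧ ∀ b ∈ B, ∃ a ∈ A, hilbertDist Ω a b < ε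

/-- The Hausdorff distance between `A` and `B` (w.r.t. the Hilbert metric of `Ω`)
is at most `r`. -/
def hausdorffDistLE (Ω A B : Set (PSpace d)) (r : ℝ) : Prop :=
  ∀ ε : ℝ, 0 < ε → hausLT Ω A B (r + ε)

/-- Convergence `F n → C` in the local Hausdorff topology induced by `d_Ω`. -/
def LocalHausConv (Ω : Set (PSpace d)) (F : ℕ → Set (PSpace d)) (C : Set (PSpace d)) : Prop :=
  ∀ x ∈ Ω, ∀ r : ℝ, 0 < r → ∀ ε : ℝ, 0 < ε →
    ∀ᶠ n in atTop, hausLT Ω (F n ∩ hBall Ω x r) (C ∩ hBall Ω x r) ε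

/-- A collection `𝒮` of closed subsets of `Ω` is closed and discrete in the local Hausdorff
topology: any sequence in `𝒮` converging to a nonempty closed subset of `Ω` has limit in `𝒮`
and is eventually equal to its limit. -/
def ClosedAndDiscreteInLHT (Ω : Set (PSpace d)) (𝒮 : Set (Set (PSpace d))) : Prop :=
  ∀ F : ℕ → Set (PSpace d), (∀ n, F n ∈ 𝒮) →
    ∀ C : Set (PSpace d), C.Nonempty → C ⊆ Ω → closure C ∩ Ω ⊆ C → LocalHausConv Ω F C →
      C ∈ 𝒮 ∧ ∀ᶠ n in atTop, F n = C


set_option linter.unusedSectionVars false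

/-- projective domination relation -/
def DRel {E : Type*} [AddCommGroup E] [Module ℝ E] (K : Set E) (l : ℝ) (y z : E) : Prop :=
  ∃ a b : ℝ, 0 < a ∧ 0 < b ∧ a * b ≤ l ∧ a • z - y ∈ K ∧ b • y - z ∈ K

section cone
variable {E : Type*} [NormedAddCommGroup E] [NormedSpace ℝ E]

structure OCone (f : E →ₗ[ℝ] ℝ) (U : Set E) : Prop where
  add : ∀ u ∈ U, ∀ v ∈ U, u + v ∈ U
  smul : ∀ c : ℝ, 0 < c → ∀ u ∈ U, c • u ∈ U
  bd : ∃ M : ℝ, 0 < M ∧ ∀ u ∈ U, ‖u‖ ≤ M * f u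
  ne : U.Nonempty
  pos : ∀ u ∈ U, 0 < f u

variable {f : E →ₗ[ℝ] ℝ} {U : Set E}

lemma OCone.convex (h : OCone f U) : Convex ℝ U := by
  rw [convex_iff_forall_pos]
  intro x hx y hy a b ha hb _
  exact h.add _ (h.smul a ha x hx) _ (h.smul b hb y hy)

lemma OCone.cl_smul_pos (h : OCone f U) {c : ℝ} (hc : 0 < c) {u : E} (hu : u ∈ closure U) :
    c • u ∈ closure U :=
  map_mem_closure (continuous_const_smul c) hu (fun x hx => h.smul c hc x hx)

lemma OCone.cl_add (h : OCone f U) {u v : E} (hu : u ∈ closure U) (hv : v ∈ closure U) :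
    u + v ∈ closure U :=
  map_mem_closure₂ continuous_add hu hv (fun x hx y hy => h.add x hx y hy)

lemma OCone.cl_zero (h : OCone f U) : (0 : E) ∈ closure U := by
  obtain ⟨u, hu⟩ := h.ne
  have ht : Tendsto (fun c : ℝ => c • u) (nhdsWithin 0 (Ioi 0)) (nhds ((0:ℝ) • u)) :=
    ((continuous_id.smul continuous_const).tendsto 0).mono_left nhdsWithin_le_nhds
  rw [zero_smul] at ht
  refine mem_closure_of_tendsto ht ?_
  filter_upwards [self_mem_nhdsWithin] with c hc using h.smul c hc u hu

lemma OCone.cl_smul (h : OCone f U) {c : ℝ} (hc : 0 ≤ c) {u : E} (hu : u ∈ closure U) :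
    c • u ∈ closure U := by
  rcases hc.eq_or_lt with rfl | hc
  · simpa using h.cl_zero
  · exact h.cl_smul_pos hc hu

lemma OCone.add_cl (h : OCone f U) (ho : IsOpen U) {u v : E} (hu : u ∈ U) (hv : v ∈ closure U) :
    u + v ∈ U := by
  have h1 := h.convex.combo_interior_closure_mem_interior (x := u) (y := v)
    (by rwa [ho.interior_eq]) hv (a := 1/2) (b := 1/2) (by norm_num) (by norm_num) (by norm_num)
  rw [ho.interior_eq] at h1
  have h2 := h.smul 2 (by norm_num) _ h1
  rw [smul_add, smul_smul, smul_smul] at h2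
  norm_num at h2
  exact h2

variable [FiniteDimensional ℝ E]

lemma OCone.cl_bd (h : OCone f U) : ∃ M : ℝ, 0 < M ∧ ∀ u ∈ closure U, ‖u‖ ≤ M * f u := by
  obtain ⟨M, hM, hb⟩ := h.bd
  refine ⟨M, hM, fun u hu => ?_⟩
  have hf : Continuous f := f.continuous_of_finiteDimensional
  have : IsClosed {u : E | ‖u‖ ≤ M * f u} :=
    isClosed_le continuous_norm (continuous_const.mul hf)
  exact closure_minimal hb this hu

lemma OCone.cl_nonneg (h : OCone f U) {u : E} (hu : u ∈ closure U) : 0 ≤ f u := by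
  obtain ⟨M, hM, hb⟩ := h.cl_bd
  have := hb u hu
  have h0 := norm_nonneg u
  by_contra hlt
  push Not at hlt
  nlinarith [mul_neg_of_pos_of_neg hM hlt]

lemma OCone.cl_pos (h : OCone f U) {u : E} (hu : u ∈ closure U) (h0 : u ≠ 0) : 0 < f u := by
  obtain ⟨M, hM, hb⟩ := h.cl_bd
  have := hb u hu
  have h0 := norm_pos_iff.2 h0
  by_contra hlt
  push Not at hlt
  nlinarith [mul_nonpos_of_nonneg_of_nonpos hM.le hlt]

lemma OCone.compact_slice (h : OCone f U) : IsCompact {u ∈ closure U | f u = 1} := by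
  obtain ⟨M, hM, hb⟩ := h.cl_bd
  have hf : Continuous f := f.continuous_of_finiteDimensional
  have : ProperSpace E := FiniteDimensional.proper ℝ E
  refine Metric.isCompact_of_isClosed_isBounded
    (isClosed_closure.inter (isClosed_eq hf continuous_const)) ?_
  refine (Metric.isBounded_closedBall (x := (0:E)) (r := M)).subset ?_
  rintro u ⟨hu, hu1⟩
  have := hb u hu
  rw [hu1] at this
  simpa using this

/-- The set of normalized vectors dominated by the cone on `p, y`. -/
def NSet (f : E →ₗ[ℝ] ℝ) (K : Set E) (l : ℝ) (p y : E) : Set E :=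
  {q | (q ∈ K ∧ f q = 1) ∧ ∃ s r : ℝ, 0 ≤ s ∧ 0 ≤ r ∧ s • p + r • y - q ∈ K ∧
    l • q - (s • p + r • y) ∈ K}

lemma OCone.NSet_closed (h : OCone f U) (l : ℝ) {p y : E} (hp : f p = 1) (hy : f y = 1) :
    IsClosed (NSet f (closure U) l p y) := by
  have hc : IsCompact ({u ∈ closure U | f u = 1} ×ˢ (Icc (0:ℝ) l ×ˢ Icc (0:ℝ) l)) :=
    h.compact_slice.prod (isCompact_Icc.prod isCompact_Icc)
  have hcl : IsClosed {t : E × ℝ × ℝ | t.2.1 • p + t.2.2 • y - t.1 ∈ closure U ∧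
      l • t.1 - (t.2.1 • p + t.2.2 • y) ∈ closure U} :=
    (isClosed_closure.preimage (by fun_prop)).inter (isClosed_closure.preimage (by fun_prop))
  have := ((hc.inter_right hcl).image continuous_fst).isClosed
  convert this using 1
  ext q
  constructor
  · rintro ⟨hq, s, r, hs, hr, h1, h2⟩
    have h3 := h.cl_nonneg h2
    simp [hp, hy, hq.2] at h3
    exact ⟨(q, s, r), ⟨⟨hq, ⟨hs, by simp; linarith⟩, ⟨hr, by simp; linarith⟩⟩, h1, h2⟩, rfl⟩
  · rintro ⟨⟨q', s, r⟩, ⟨⟨hq, hs, hr⟩, h1, h2⟩, rfl⟩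
    exact ⟨hq, s, r, hs.1, hr.1, h1, h2⟩

lemma OCone.NSet_mono (h : OCone f U) {l l' : ℝ} (hl : l ≤ l') {p y : E} :
    NSet f (closure U) l p y ⊆ NSet f (closure U) l' p y := by
  rintro q ⟨hq, s, r, hs, hr, h1, h2⟩
  refine ⟨hq, s, r, hs, hr, h1, ?_⟩
  have := h.cl_add h2 (h.cl_smul (sub_nonneg.2 hl) hq.1)
  convert this using 1
  module

lemma OCone.NSet_of_DRel (h : OCone f U) {l : ℝ} {q p y : E} {s r : ℝ} (hs : 0 ≤ s) (hr : 0 ≤ r)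
    (hq : q ∈ closure U) (hq1 : f q = 1) (hD : DRel (closure U) l q (s • p + r • y)) :
    q ∈ NSet f (closure U) l p y := by
  obtain ⟨a, b, ha, hb, hab, h1, h2⟩ := hD
  refine ⟨⟨hq, hq1⟩, a * s, a * r, by positivity, by positivity, ?_, ?_⟩
  · convert h1 using 1
    module
  · have := h.cl_add (h.cl_smul ha.le h2) (h.cl_smul (sub_nonneg.2 hab) hq)
    convert this using 1
    module

lemma OCone.DRel_of_NSet (h : OCone f U) {l : ℝ} (hl : 0 < l) {q y : E} (hy : f y = 1)
    (hD : q ∈ NSet f (closure U) l y y) : DRel (closure U) l q y := by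
  obtain ⟨⟨hq, hq1⟩, s, r, hs, hr, h1, h2⟩ := hD
  have h3 := h.cl_nonneg h1
  simp [hy, hq1] at h3
  have hp : 0 < s + r := by linarith
  refine ⟨s + r, l / (s + r), hp, by positivity, ?_, ?_, ?_⟩
  · rw [mul_div_cancel₀ _ hp.ne']
  · convert h1 using 1
    module
  · have := h.cl_smul (inv_pos.2 hp).le h2
    convert this using 1
    have e : s • y + r • y = (s + r) • y := by module
    rw [e, smul_sub, smul_smul, smul_smul, inv_mul_cancel₀ hp.ne', one_smul, div_eq_inv_mul]

lemma DRel.symm {K : Set E} {l : ℝ} {y z : E} (h : DRel K l y z) : DRel K l z y := by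
  obtain ⟨a, b, ha, hb, hab, h1, h2⟩ := h
  exact ⟨b, a, hb, ha, by linarith [mul_comm a b], h2, h1⟩

lemma OCone.DRel_trans (h : OCone f U) {l l' : ℝ} {x y z : E} (h1 : DRel (closure U) l x y)
    (h2 : DRel (closure U) l' y z) : DRel (closure U) (l * l') x z := by
  obtain ⟨a, b, ha, hb, hab, h1, h1'⟩ := h1
  obtain ⟨a', b', ha', hb', hab', h2, h2'⟩ := h2
  refine ⟨a * a', b * b', by positivity, by positivity, ?_, ?_, ?_⟩
  · calc a * a' * (b * b') = (a * b) * (a' * b') := by ring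
      _ ≤ l * l' := mul_le_mul hab hab' (by positivity) (le_trans (by positivity) hab)
  · have := h.cl_add (h.cl_smul ha.le h2) h1
    convert this using 1
    module
  · have := h.cl_add (h.cl_smul hb'.le h1') h2'
    convert this using 1
    module

lemma OCone.DRel_refl (h : OCone f U) {l : ℝ} (hl : 1 ≤ l) (x : E) :
    DRel (closure U) l x x :=
  ⟨1, 1, one_pos, one_pos, by linarith, by simpa using h.cl_zero, by simpa using h.cl_zero⟩

/-- segments joining related boundary points avoid `U` -/
lemma OCone.edge (h : OCone f U) (ho : IsOpen U) {l : ℝ} {y z : E} (hy : y ∉ U)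
    (hD : DRel (closure U) l y z) {s r : ℝ} (hs : 0 ≤ s) (hr : 0 ≤ r) : s • y + r • z ∉ U := by
  intro hU
  obtain ⟨a, b, ha, hb, hab, h1, h2⟩ := hD
  have h3 := h.add_cl ho hU (h.cl_smul hr h2)
  have e : s • y + r • z + r • (b • y - z) = (s + r * b) • y := by module
  rw [e] at h3
  have hp : 0 ≤ s + r * b := by positivity
  rcases hp.eq_or_lt with h0 | h0
  · rw [← h0, zero_smul] at h3
    have := h.pos _ h3
    simp at this
  · have := h.smul _ (inv_pos.2 h0) _ h3
    rw [smul_smul, inv_mul_cancel₀ h0.ne', one_smul] at this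
    exact hy this


lemma OCone.mid (h : OCone f U) {l : ℝ} (hl : 1 ≤ l) {y z : E}
    (hy : y ∈ closure U) (hz : z ∈ closure U) (hy1 : f y = 1) (hz1 : f z = 1)
    (hn : ¬ DRel (closure U) (l * l) y z) :
    ∃ s r : ℝ, 0 ≤ s ∧ 0 ≤ r ∧ s + r = 1 ∧ s • y + r • z ∉ NSet f (closure U) l y y ∧
      s • y + r • z ∉ NSet f (closure U) l z z := by
  by_contra hcon
  push Not at hcon
  have hl0 : 0 < l := by linarith
  have hpre : IsPreconnected (segment ℝ y z) := (convex_segment y z).isPreconnected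
  rw [isPreconnected_closed_iff] at hpre
  have hself : ∀ w, w ∈ closure U → f w = 1 → w ∈ NSet f (closure U) l w w := by
    intro w hw hw1
    refine h.NSet_of_DRel (s := 1) (r := 0) (by norm_num) le_rfl hw hw1 ?_
    simpa using h.DRel_refl hl w
  obtain ⟨m, -, hm1, hm2⟩ := hpre _ _ (h.NSet_closed l hy1 hy1) (h.NSet_closed l hz1 hz1)
    (by
      rintro m ⟨s, r, hs, hr, hsr, rfl⟩
      by_cases h1 : s • y + r • z ∈ NSet f (closure U) l y y
      · exact Or.inl h1
      · exact Or.inr (hcon s r hs hr hsr h1))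
    ⟨y, left_mem_segment ℝ y z, hself y hy hy1⟩ ⟨z, right_mem_segment ℝ y z, hself z hz hz1⟩
  exact hn (h.DRel_trans (h.DRel_of_NSet hl0 hy1 hm1).symm (h.DRel_of_NSet hl0 hz1 hm2))

lemma OCone.end_not (h : OCone f U) (ho : IsOpen U) {l : ℝ} (hl : 0 < l) {p y m : E}
    (hp : p ∈ U) (hmU : m ∉ U) (hy : y ∈ closure U)
    (hm : m ∉ NSet f (closure U) l y y) : m ∉ NSet f (closure U) l p y := by
  rintro ⟨hmm, s, r, hs, hr, h1, h2⟩
  rcases hs.eq_or_lt with rfl | hs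
  · exact hm ⟨hmm, 0, r, le_rfl, hr, by simpa using h1, by simpa using h2⟩
  · have h3 := h.add_cl ho (h.smul s hs p hp) (h.cl_add (h.cl_smul hr hy) h2)
    have h4 := h.smul _ (inv_pos.2 hl) _ h3
    apply hmU
    convert h4 using 1
    have e : s • p + (r • y + (l • m - (s • p + r • y))) = l • m := by module
    rw [e, smul_smul, inv_mul_cancel₀ hl.ne', one_smul]

lemma OCone.choose_q (h : OCone f U) (ho : IsOpen U) {l : ℝ} (hl : 0 < l) {p y z m : E}
    (hp : p ∈ U) (hp1 : f p = 1) (hmU : m ∉ U) (hy : y ∈ closure U) (hz : z ∈ closure U)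
    (hy1 : f y = 1) (hz1 : f z = 1)
    (hmy : m ∉ NSet f (closure U) l y y) (hmz : m ∉ NSet f (closure U) l z z) :
    ∃ t : ℝ, 0 ≤ t ∧ t < 1 ∧ (1 - t) • p + t • m ∉ NSet f (closure U) l p y ∧
      (1 - t) • p + t • m ∉ NSet f (closure U) l p z := by
  have h1 := h.end_not ho hl hp hmU hy hmy
  have h2 := h.end_not ho hl hp hmU hz hmz
  have hO : IsOpen ((fun t : ℝ => (1 - t) • p + t • m) ⁻¹'
      ((NSet f (closure U) l p y)ᶜ ∩ (NSet f (closure U) l p z)ᶜ)) :=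
    ((h.NSet_closed l hp1 hy1).isOpen_compl.inter
      (h.NSet_closed l hp1 hz1).isOpen_compl).preimage (by fun_prop)
  have hmem : (1:ℝ) ∈ ((fun t : ℝ => (1 - t) • p + t • m) ⁻¹'
      ((NSet f (closure U) l p y)ᶜ ∩ (NSet f (closure U) l p z)ᶜ)) := by
    simp [h1, h2]
  have hev := hO.mem_nhds hmem
  have hev2 : ∀ᶠ t in nhdsWithin (1:ℝ) (Iio 1), t ∈ ((fun t : ℝ => (1 - t) • p + t • m) ⁻¹'
      ((NSet f (closure U) l p y)ᶜ ∩ (NSet f (closure U) l p z)ᶜ)) :=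
    nhdsWithin_le_nhds hev
  have hev3 : ∀ᶠ t in nhdsWithin (1:ℝ) (Iio 1), (0:ℝ) < t :=
    nhdsWithin_le_nhds (lt_mem_nhds one_pos)
  obtain ⟨t, ⟨ht1, ht2⟩, ht3⟩ := ((hev2.and hev3).and self_mem_nhdsWithin).exists
  exact ⟨t, ht2.le, ht3, ht1.1, ht1.2⟩

lemma OCone.exists_dom (h : OCone f U) (ho : IsOpen U) {q e : E} (he : e ∈ U) :
    ∃ a : ℝ, 0 < a ∧ a • e - q ∈ U := by
  have hO : IsOpen ((fun t : ℝ => e - t • q) ⁻¹' U) := ho.preimage (by fun_prop)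
  have hev : ∀ᶠ t in nhdsWithin (0:ℝ) (Ioi 0), e - t • q ∈ U :=
    nhdsWithin_le_nhds (hO.mem_nhds (by simpa using he))
  obtain ⟨t, ht, ht0⟩ := (hev.and self_mem_nhdsWithin).exists
  have ht0 : 0 < t := ht0
  refine ⟨t⁻¹, inv_pos.2 ht0, ?_⟩
  have := h.smul _ (inv_pos.2 ht0) _ ht
  rwa [smul_sub, smul_smul, inv_mul_cancel₀ ht0.ne', one_smul] at this

lemma OCone.eventually_DRel (h : OCone f U) (ho : IsOpen U) {q e : E} (hq : q ∈ U) (he : e ∈ U)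
    {qs es : ℕ → E} (hqs : Tendsto qs atTop (nhds q)) (hes : Tendsto es atTop (nhds e)) :
    ∃ l : ℝ, ∀ᶠ n in atTop, DRel (closure U) l (qs n) (es n) := by
  obtain ⟨a, ha, h1⟩ := h.exists_dom ho (q := q) he
  obtain ⟨b, hb, h2⟩ := h.exists_dom ho (q := e) hq
  refine ⟨a * b, ?_⟩
  have t1 := ((hes.const_smul a).sub hqs).eventually (ho.mem_nhds h1)
  have t2 := ((hqs.const_smul b).sub hes).eventually (ho.mem_nhds h2)
  filter_upwards [t1, t2] with n h1 h2
  exact ⟨a, b, ha, hb, le_rfl, subset_closure h1, subset_closure h2⟩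

lemma DRel.smul_iff {K : Set E} (hK : ∀ c : ℝ, 0 < c → ∀ u ∈ K, c • u ∈ K) {l : ℝ} {y z : E}
    {c c' : ℝ} (hc : 0 < c) (hc' : 0 < c') (h : DRel K l (c • y) (c' • z)) : DRel K l y z := by
  obtain ⟨a, b, ha, hb, hab, h1, h2⟩ := h
  refine ⟨a * c' / c, b * c / c', by positivity, by positivity, ?_, ?_, ?_⟩
  · calc a * c' / c * (b * c / c') = a * b := by field_simp
      _ ≤ l := hab
  · have := hK c⁻¹ (inv_pos.2 hc) _ h1
    convert this using 1
    rw [smul_sub, smul_smul, smul_smul, smul_smul, inv_mul_cancel₀ hc.ne', one_smul]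
    congr 2
    field_simp
  · have := hK c'⁻¹ (inv_pos.2 hc') _ h2
    convert this using 1
    rw [smul_sub, smul_smul, smul_smul, smul_smul, inv_mul_cancel₀ hc'.ne', one_smul]
    congr 2
    field_simp

lemma DRel.map_iff {K : Set E} (g : E ≃ₗ[ℝ] E) (hg : ∀ v, g v ∈ K ↔ v ∈ K) {l : ℝ} {y z : E}
    (h : DRel K l (g y) (g z)) : DRel K l y z := by
  obtain ⟨a, b, ha, hb, hab, h1, h2⟩ := h
  refine ⟨a, b, ha, hb, hab, ?_, ?_⟩
  · rw [← hg]; simpa using h1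
  · rw [← hg]; simpa using h2

lemma equiv_closure (g : E ≃ₗ[ℝ] E) {A : Set E} (hg : ∀ v, g v ∈ A ↔ v ∈ A) (v : E) :
    g v ∈ closure A ↔ v ∈ closure A := by
  have e : (g.toContinuousLinearEquiv.toHomeomorph) ⁻¹' A = A := by
    ext v; exact hg v
  have := (g.toContinuousLinearEquiv.toHomeomorph).preimage_closure A
  rw [e] at this
  exact Set.ext_iff.1 this v


lemma OCone.per_n {V K₀ : Set E} (h : OCone f U) (ho : IsOpen U) (hV : OCone f V) (hVU : V ⊆ U)
    (hcl : closure V ∩ U ⊆ V) (hK1 : ∀ q ∈ K₀, f q = 1)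
    (hg : ∀ q ∈ V, ∃ g : E ≃ₗ[ℝ] E, (∀ v, g v ∈ U ↔ v ∈ U) ∧ (∀ v, g v ∈ V ↔ v ∈ V) ∧
      ∃ c : ℝ, 0 < c ∧ c • g q ∈ K₀)
    {p y z : E} {l L : ℝ} (hl : 1 ≤ l) (hp : p ∈ V) (hp1 : f p = 1)
    (hy : y ∈ closure V) (hz : z ∈ closure V) (hy1 : f y = 1) (hz1 : f z = 1) (hyU : y ∉ U)
    (hD : DRel (closure U) L y z) (hn : ¬ DRel (closure U) (l * l) y z) :
    ∃ (v : Fin 3 → E) (w : Fin 3 → ℝ), (∀ i, v i ∈ closure V ∧ f (v i) = 1) ∧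
      w ∈ stdSimplex ℝ (Fin 3) ∧ ∑ i, w i • v i ∈ K₀ ∧
      (∀ s r : ℝ, 0 ≤ s → 0 ≤ r → s • v 1 + r • v 2 ∉ U) ∧
      (∀ s r : ℝ, 0 ≤ s → 0 ≤ r → ∀ l' ≤ l,
        ¬ DRel (closure U) l' (∑ i, w i • v i) (s • v 0 + r • v 1)) ∧
      (∀ s r : ℝ, 0 ≤ s → 0 ≤ r → ∀ l' ≤ l,
        ¬ DRel (closure U) l' (∑ i, w i • v i) (s • v 0 + r • v 2)) := by
  have hVU' : closure V ⊆ closure U := closure_mono hVU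
  have hl0 : 0 < l := by linarith
  obtain ⟨s, r, hs, hr, hsr, hmy, hmz⟩ := h.mid hl (hVU' hy) (hVU' hz) hy1 hz1 hn
  have hmU : s • y + r • z ∉ U := h.edge ho hyU hD hs hr
  obtain ⟨t, ht0, ht1, hqy, hqz⟩ := h.choose_q ho hl0 (hVU hp) hp1 hmU (hVU' hy) (hVU' hz)
    hy1 hz1 hmy hmz
  set q : E := (1 - t) • p + t • (s • y + r • z) with hq
  have hm : s • y + r • z ∈ closure V := hV.cl_add (hV.cl_smul hs hy) (hV.cl_smul hr hz)
  have ht1' : 0 < 1 - t := by linarith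
  have hqU : q ∈ U := h.add_cl ho (h.smul _ ht1' _ (hVU hp)) (h.cl_smul ht0 (hVU' hm))
  have hqV : q ∈ V := hcl ⟨hV.cl_add (hV.cl_smul ht1'.le (subset_closure hp))
    (hV.cl_smul ht0 hm), hqU⟩
  have hq1 : f q = 1 := by
    simp only [hq, map_add, map_smul, hp1, hy1, hz1, smul_eq_mul, mul_one, hsr]; ring
  obtain ⟨g, hgU, hgV, c, hc, hcK⟩ := hg q hqV
  have gV := equiv_closure g hgV
  have gU := equiv_closure g hgU
  have key : ∀ x, x ∈ closure V → f x = 1 → 0 < f (g x) := by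
    intro x hx hx1
    refine hV.cl_pos ((gV x).2 hx) ?_
    intro h0
    have : x = 0 := by simpa using h0
    rw [this] at hx1
    simp at hx1
  have kp := key p (subset_closure hp) hp1
  have ky := key y hy hy1
  have kz := key z hz hz1
  have nv : ∀ x, x ∈ closure V → 0 < f (g x) →
      (f (g x))⁻¹ • g x ∈ closure V ∧ f ((f (g x))⁻¹ • g x) = 1 := by
    intro x hx hx1
    refine ⟨hV.cl_smul (inv_pos.2 hx1).le ((gV x).2 hx), ?_⟩
    rw [map_smul, smul_eq_mul, inv_mul_cancel₀ hx1.ne']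
  have hsum : ∑ i, (![c * (1 - t) * f (g p), c * (t * s) * f (g y), c * (t * r) * f (g z)] : Fin 3 → ℝ) i
      • (![(f (g p))⁻¹ • g p, (f (g y))⁻¹ • g y, (f (g z))⁻¹ • g z] : Fin 3 → E) i = c • g q := by
    simp only [Fin.sum_univ_three, Matrix.cons_val_zero, Matrix.cons_val_one, Matrix.cons_val,
      smul_smul, mul_assoc, mul_inv_cancel₀ kp.ne', mul_inv_cancel₀ ky.ne',
      mul_inv_cancel₀ kz.ne', mul_one, hq, map_add, map_smul, smul_add, add_assoc]
  have noD : ∀ (x : E) (kx : 0 < f (g x)), q ∉ NSet f (closure U) l p x →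
      ∀ s r : ℝ, 0 ≤ s → 0 ≤ r → ∀ l' ≤ l,
        ¬ DRel (closure U) l' (c • g q) (s • (f (g p))⁻¹ • g p + r • (f (g x))⁻¹ • g x) := by
    intro x kx hqx s r hs hr l' hl' hDD
    apply hqx
    have e : s • (f (g p))⁻¹ • g p + r • (f (g x))⁻¹ • g x =
        (1:ℝ) • g ((s * (f (g p))⁻¹) • p + (r * (f (g x))⁻¹) • x) := by
      simp [smul_smul]
    rw [e] at hDD
    have h2 := DRel.map_iff g gU
      (DRel.smul_iff (fun c hc u hu => h.cl_smul_pos hc hu) hc one_pos hDD)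
    exact h.NSet_mono hl' (h.NSet_of_DRel (by positivity) (by positivity)
      (subset_closure hqU) hq1 h2)
  refine ⟨![(f (g p))⁻¹ • g p, (f (g y))⁻¹ • g y, (f (g z))⁻¹ • g z],
    ![c * (1 - t) * f (g p), c * (t * s) * f (g y), c * (t * r) * f (g z)], ?_, ?_, ?_, ?_, ?_, ?_⟩
  · intro i
    fin_cases i
    · exact nv p (subset_closure hp) kp
    · exact nv y hy ky
    · exact nv z hz kz
  · constructor
    · intro i
      fin_cases i
      · simp; positivity
      · simp; positivity
      · simp; positivity
    · have h1 := hK1 _ hcK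
      have h2 : f q = 1 := hq1
      simp only [hq, map_add, map_smul, smul_eq_mul] at h1
      simp only [Fin.sum_univ_three, Matrix.cons_val_zero, Matrix.cons_val_one, Matrix.cons_val]
      linear_combination h1
  · rw [hsum]; exact hcK
  · intro s' r' hs' hr' hU
    have e : s' • (f (g y))⁻¹ • g y + r' • (f (g z))⁻¹ • g z =
        g ((s' * (f (g y))⁻¹) • y + (r' * (f (g z))⁻¹) • z) := by
      simp [smul_smul]
    have hU' : s' • (f (g y))⁻¹ • g y + r' • (f (g z))⁻¹ • g z ∈ U := hU
    rw [e, hgU] at hU'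
    exact h.edge ho hyU hD (by positivity) (by positivity) hU'
  · rw [hsum]; exact noD y ky hqy
  · rw [hsum]; exact noD z kz hqz

theorem OCone.core {V K₀ : Set E} (h : OCone f U) (ho : IsOpen U) (hV : OCone f V) (hVU : V ⊆ U)
    (hcl : closure V ∩ U ⊆ V) (hKc : IsCompact K₀) (hKV : K₀ ⊆ V) (hK1 : ∀ q ∈ K₀, f q = 1)
    (hg : ∀ q ∈ V, ∃ g : E ≃ₗ[ℝ] E, (∀ v, g v ∈ U ↔ v ∈ U) ∧ (∀ v, g v ∈ V ↔ v ∈ V) ∧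
      ∃ c : ℝ, 0 < c ∧ c • g q ∈ K₀)
    (hseq : ∀ l : ℝ, 1 ≤ l → ∃ y z : E, y ∈ closure V ∧ z ∈ closure V ∧ f y = 1 ∧ f z = 1 ∧ y ∉ U ∧
      (∃ L, DRel (closure U) L y z) ∧ ¬ DRel (closure U) (l * l) y z) :
    ∃ v : Fin 3 → E, (∀ i, v i ∈ closure V) ∧ (∀ i, f (v i) = 1) ∧
      (∃ w : Fin 3 → ℝ, (∀ i, 0 ≤ w i) ∧ ∑ i, w i • v i ∈ U) ∧
      ∀ w : Fin 3 → ℝ, (∀ i, 0 ≤ w i) → (∃ i, w i = 0) → ∑ i, w i • v i ∉ U := by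
  obtain ⟨p₀, hp₀⟩ := hV.ne
  have hp0 := hV.pos _ hp₀
  have hp : (f p₀)⁻¹ • p₀ ∈ V := hV.smul _ (inv_pos.2 hp0) _ hp₀
  have hp1 : f ((f p₀)⁻¹ • p₀) = 1 := by
    rw [map_smul, smul_eq_mul, inv_mul_cancel₀ hp0.ne']
  have hall : ∀ n : ℕ, ∃ (v : Fin 3 → E) (w : Fin 3 → ℝ), (∀ i, v i ∈ closure V ∧ f (v i) = 1) ∧
      w ∈ stdSimplex ℝ (Fin 3) ∧ ∑ i, w i • v i ∈ K₀ ∧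
      (∀ s r : ℝ, 0 ≤ s → 0 ≤ r → s • v 1 + r • v 2 ∉ U) ∧
      (∀ s r : ℝ, 0 ≤ s → 0 ≤ r → ∀ l' ≤ (n + 1 : ℝ),
        ¬ DRel (closure U) l' (∑ i, w i • v i) (s • v 0 + r • v 1)) ∧
      (∀ s r : ℝ, 0 ≤ s → 0 ≤ r → ∀ l' ≤ (n + 1 : ℝ),
        ¬ DRel (closure U) l' (∑ i, w i • v i) (s • v 0 + r • v 2)) := by
    intro n
    have hn : (1:ℝ) ≤ n + 1 := by linarith [Nat.cast_nonneg (α := ℝ) n]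
    obtain ⟨y, z, hy, hz, hy1, hz1, hyU, ⟨L, hL⟩, hnD⟩ := hseq (n + 1) hn
    exact h.per_n ho hV hVU hcl hK1 hg hn hp hp1 hy hz hy1 hz1 hyU hL hnD
  choose v w hv hw hq e0 e1 e2 using hall
  have hcomp : IsCompact ((Set.pi univ fun _ : Fin 3 => {u ∈ closure V | f u = 1}) ×ˢ
      stdSimplex ℝ (Fin 3)) :=
    (isCompact_univ_pi fun _ => hV.compact_slice).prod (isCompact_stdSimplex ℝ (Fin 3))
  obtain ⟨⟨v', w'⟩, ⟨hv', hw'⟩, φ, hφ, hlim⟩ := hcomp.tendsto_subseq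
    (x := fun n => (v n, w n)) (fun n => ⟨fun i _ => hv n i, hw n⟩)
  have hlim1 : Tendsto (fun n => v (φ n)) atTop (nhds v') :=
    (continuous_fst.tendsto _).comp hlim
  have hlim2 : Tendsto (fun n => w (φ n)) atTop (nhds w') :=
    (continuous_snd.tendsto _).comp hlim
  have hvi : ∀ i, Tendsto (fun n => v (φ n) i) atTop (nhds (v' i)) := tendsto_pi_nhds.1 hlim1
  have hwi : ∀ i, Tendsto (fun n => w (φ n) i) atTop (nhds (w' i)) := tendsto_pi_nhds.1 hlim2
  have hqlim : Tendsto (fun n => ∑ i, w (φ n) i • v (φ n) i) atTop (nhds (∑ i, w' i • v' i)) :=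
    tendsto_finsetSum _ fun i _ => (hwi i).smul (hvi i)
  have hQ : ∑ i, w' i • v' i ∈ K₀ :=
    hKc.isClosed.mem_of_tendsto hqlim (Eventually.of_forall fun n => hq (φ n))
  have hQU : ∑ i, w' i • v' i ∈ U := hVU (hKV hQ)
  have comb : ∀ (s r : ℝ) (i j : Fin 3), Tendsto (fun n => s • v (φ n) i + r • v (φ n) j) atTop
      (nhds (s • v' i + r • v' j)) := fun s r i j => ((hvi i).const_smul s).add ((hvi j).const_smul r)
  have noU : ∀ j : Fin 3, (∀ n : ℕ, ∀ s r : ℝ, 0 ≤ s → 0 ≤ r → ∀ l' ≤ (n + 1 : ℝ),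
        ¬ DRel (closure U) l' (∑ i, w n i • v n i) (s • v n 0 + r • v n j)) →
      ∀ s r : ℝ, 0 ≤ s → 0 ≤ r → s • v' 0 + r • v' j ∉ U := by
    intro j hj s r hs hr hU
    obtain ⟨l, hl⟩ := h.eventually_DRel ho hQU hU hqlim (comb s r 0 j)
    obtain ⟨N, hN⟩ := exists_nat_ge l
    obtain ⟨n, hn1, hn2⟩ := (hl.and (eventually_ge_atTop N)).exists
    refine hj (φ n) s r hs hr l ?_ hn1
    have : (N:ℝ) ≤ φ n := by exact_mod_cast hn2.trans (hφ.id_le n)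
    linarith
  refine ⟨v', fun i => (hv' i trivial).1, fun i => (hv' i trivial).2, ⟨w', hw'.1, hQU⟩, ?_⟩
  rintro u hu ⟨i, hi⟩ hU
  rw [Fin.sum_univ_three] at hU
  fin_cases i
  · simp only [Fin.zero_eta] at hi
    rw [hi, zero_smul, zero_add] at hU
    obtain ⟨n, hn⟩ := ((comb (u 1) (u 2) 1 2).eventually (ho.mem_nhds hU)).exists
    exact e0 (φ n) _ _ (hu 1) (hu 2) hn
  · simp only [Fin.mk_one] at hi
    rw [hi, zero_smul, add_zero] at hU
    exact noU 2 e2 _ _ (hu 0) (hu 2) hU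
  · simp only [Fin.reduceFinMk] at hi
    rw [hi, zero_smul, add_zero] at hU
    exact noU 1 e1 _ _ (hu 0) (hu 1) hU

lemma linInd_of {v : Fin 3 → E} (hv1 : ∀ i, f (v i) = 1)
    (hw : ∃ w : Fin 3 → ℝ, (∀ i, 0 ≤ w i) ∧ ∑ i, w i • v i ∈ U)
    (hno : ∀ w : Fin 3 → ℝ, (∀ i, 0 ≤ w i) → (∃ i, w i = 0) → ∑ i, w i • v i ∉ U) :
    LinearIndependent ℝ v := by
  rw [Fintype.linearIndependent_iff]
  intro g hg
  obtain ⟨w, hw0, hwU⟩ := hw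
  have hsum : ∑ i, g i = 0 := by
    have := congrArg f hg
    simpa [map_sum, hv1] using this
  by_contra hne
  push Not at hne
  have hpos : ∃ i, 0 < g i := by
    by_contra hcon
    push Not at hcon
    have := (Finset.sum_eq_zero_iff_of_nonpos (fun i _ => hcon i)).1 hsum
    obtain ⟨i, hi⟩ := hne
    exact hi (this i (Finset.mem_univ i))
  obtain ⟨i₀, hi₀⟩ := hpos
  obtain ⟨i, hi, hmin⟩ := Finset.exists_min_image (Finset.univ.filter fun i => 0 < g i)
    (fun i => w i / g i) ⟨i₀, by simp [hi₀]⟩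
  simp only [Finset.mem_filter, Finset.mem_univ, true_and] at hi hmin
  refine hno (fun j => w j - w i / g i * g j) ?_ ⟨i, by field_simp; simp⟩ ?_
  · intro j
    rcases le_or_gt (g j) 0 with hj | hj
    · have : 0 ≤ w i / g i := div_nonneg (hw0 i) hi.le
      nlinarith [hw0 j]
    · have := hmin j hj
      rw [le_div_iff₀ hj] at this
      linarith
  · have : ∑ j, (w j - w i / g i * g j) • v j = ∑ j, w j • v j - (w i / g i) • ∑ j, g j • v j := by
      simp only [sub_smul, Finset.sum_sub_distrib, Finset.smul_sum, smul_smul]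
    simp only [this, hg, smul_zero, sub_zero]
    exact hwU

end cone
section proj


lemma continuous_pmk :
    Continuous (fun v : {v : Fin d → ℝ // v ≠ 0} => (Projectivization.mk ℝ v.1 v.2 : PSpace d)) :=
  continuous_quotient_mk'

lemma pmk_eq_iff {v w : Fin d → ℝ} (hv : v ≠ 0) (hw : w ≠ 0) :
    (Projectivization.mk ℝ v hv : PSpace d) = Projectivization.mk ℝ w hw ↔
      ∃ a : ℝ, a ≠ 0 ∧ a • w = v := by
  rw [Projectivization.mk_eq_mk_iff']
  constructor
  · rintro ⟨a, ha⟩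
    refine ⟨a, ?_, ha⟩
    rintro rfl
    exact hv (by simpa using ha.symm)
  · rintro ⟨a, -, ha⟩
    exact ⟨a, ha⟩

lemma pmk_smul {v : Fin d → ℝ} (hv : v ≠ 0) {a : ℝ} (ha : a ≠ 0) (h : a • v ≠ 0) :
    (Projectivization.mk ℝ (a • v) h : PSpace d) = Projectivization.mk ℝ v hv :=
  (pmk_eq_iff h hv).2 ⟨a, ha, rfl⟩

/-- image of an open set of vectors is a neighbourhood -/
lemma pmk_nhds {v : Fin d → ℝ} (hv : v ≠ 0) {N : Set (Fin d → ℝ)} (hN : IsOpen N) (hvN : v ∈ N) :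
    {x : PSpace d | ∃ w ∈ N, ∃ hw : w ≠ 0, x = Projectivization.mk ℝ w hw} ∈
      nhds (Projectivization.mk ℝ v hv : PSpace d) := by
  refine IsOpen.mem_nhds ?_ ⟨v, hvN, hv, rfl⟩
  have : IsOpen ((fun v : {v : Fin d → ℝ // v ≠ 0} =>
      (Projectivization.mk ℝ v.1 v.2 : PSpace d)) ⁻¹'
      {x : PSpace d | ∃ w ∈ N, ∃ hw : w ≠ 0, x = Projectivization.mk ℝ w hw}) := by
    have e : ((fun v : {v : Fin d → ℝ // v ≠ 0} =>
      (Projectivization.mk ℝ v.1 v.2 : PSpace d)) ⁻¹'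
      {x : PSpace d | ∃ w ∈ N, ∃ hw : w ≠ 0, x = Projectivization.mk ℝ w hw}) =
      ⋃ (a : ℝ) (_ : a ≠ 0), {v : {v : Fin d → ℝ // v ≠ 0} | a • v.1 ∈ N} := by
      ext ⟨u, hu⟩
      simp only [mem_preimage, mem_ofPred_eq, mem_iUnion, exists_prop]
      constructor
      · rintro ⟨w, hw, hw0, h⟩
        obtain ⟨a, ha, rfl⟩ := (pmk_eq_iff hw0 hu).1 h.symm
        exact ⟨a, ha, hw⟩
      · rintro ⟨a, ha, h⟩
        exact ⟨a • u, h, smul_ne_zero ha hu, (pmk_smul hu ha _).symm⟩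
    rw [e]
    exact isOpen_iUnion fun a => isOpen_iUnion fun _ => hN.preimage (by fun_prop)
  exact this

lemma chartMap_mk (f : (Fin d → ℝ) →ₗ[ℝ] ℝ) {v : Fin d → ℝ} (hv : v ≠ 0) :
    chartMap f (Projectivization.mk ℝ v hv) = (f v)⁻¹ • v := by
  obtain ⟨a, ha⟩ := Projectivization.exists_smul_eq_mk_rep ℝ v hv
  unfold chartMap
  rw [← ha, Units.smul_def, map_smul, smul_smul, smul_eq_mul, mul_inv, mul_right_comm,
    inv_mul_cancel₀ a.ne_zero, one_mul]

lemma f_rep_ne (f : (Fin d → ℝ) →ₗ[ℝ] ℝ) {v : Fin d → ℝ} (hv : v ≠ 0) :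
    f (Projectivization.mk ℝ v hv : PSpace d).rep ≠ 0 ↔ f v ≠ 0 := by
  obtain ⟨a, ha⟩ := Projectivization.exists_smul_eq_mk_rep ℝ v hv
  rw [← ha, Units.smul_def, map_smul, smul_eq_mul, mul_ne_zero_iff]
  simp

lemma f_chartMap (f : (Fin d → ℝ) →ₗ[ℝ] ℝ) {x : PSpace d} (hx : f x.rep ≠ 0) :
    f (chartMap f x) = 1 := by
  simp [chartMap, hx]

lemma chartMap_ne (f : (Fin d → ℝ) →ₗ[ℝ] ℝ) {x : PSpace d} (hx : f x.rep ≠ 0) :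
    chartMap f x ≠ 0 := by
  intro h
  have := f_chartMap f hx
  rw [h] at this
  simp at this

lemma mk_chartMap (f : (Fin d → ℝ) →ₗ[ℝ] ℝ) {x : PSpace d} (hx : f x.rep ≠ 0)
    (h : chartMap f x ≠ 0) : Projectivization.mk ℝ (chartMap f x) h = x := by
  conv_rhs => rw [← x.mk_rep]
  exact pmk_smul x.rep_nonzero (inv_ne_zero hx) _

/-- the cone over a set -/
def lcone (f : (Fin d → ℝ) →ₗ[ℝ] ℝ) (A : Set (PSpace d)) : Set (Fin d → ℝ) :=
  {v | 0 < f v ∧ ∃ hv : v ≠ 0, Projectivization.mk ℝ v hv ∈ A}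

lemma chartMap_mem_lcone (f : (Fin d → ℝ) →ₗ[ℝ] ℝ) {A : Set (PSpace d)} {x : PSpace d}
    (hx : f x.rep ≠ 0) : chartMap f x ∈ lcone f A ↔ x ∈ A := by
  constructor
  · rintro ⟨-, h, h2⟩
    rwa [mk_chartMap f hx] at h2
  · intro h
    exact ⟨by rw [f_chartMap f hx]; exact one_pos, chartMap_ne f hx, by rwa [mk_chartMap f hx]⟩

lemma chartMap_mem_closure (f : (Fin d → ℝ) →ₗ[ℝ] ℝ) {A : Set (PSpace d)} {x : PSpace d}
    (hx : f x.rep ≠ 0) (h : x ∈ closure A) : chartMap f x ∈ closure (lcone f A) := by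
  have hf : Continuous f := f.continuous_of_finiteDimensional
  rw [mem_closure_iff]
  intro N hN hxN
  have hN' : IsOpen (N ∩ {v | 0 < f v}) := hN.inter (isOpen_lt continuous_const hf)
  have hn := pmk_nhds (chartMap_ne f hx) hN' ⟨hxN, by simp [f_chartMap f hx]⟩
  rw [mk_chartMap f hx] at hn
  obtain ⟨y, ⟨w, hw, hw0, rfl⟩, hyA⟩ := mem_closure_iff_nhds.1 h _ hn
  exact ⟨w, hw.1, hw.2, hw0, hyA⟩

lemma mk_mem_closure (f : (Fin d → ℝ) →ₗ[ℝ] ℝ) {A : Set (PSpace d)} {v : Fin d → ℝ} (hv : v ≠ 0)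
    (h : v ∈ closure (lcone f A)) : Projectivization.mk ℝ v hv ∈ closure A := by
  have h1 : (⟨v, hv⟩ : {v : Fin d → ℝ // v ≠ 0}) ∈ closure (Subtype.val ⁻¹' (lcone f A)) := by
    rw [closure_subtype]
    convert h using 1
    congr 1
    ext u
    simp only [mem_image, mem_preimage, Subtype.exists, exists_and_left, exists_prop]
    constructor
    · rintro ⟨a, ha, -, rfl⟩; exact ha
    · intro hu; exact ⟨u, hu, hu.2.1, rfl⟩
  exact map_mem_closure (f := fun v : {v : Fin d → ℝ // v ≠ 0} =>
      (Projectivization.mk ℝ v.1 v.2 : PSpace d)) continuous_pmk h1 (fun u hu => hu.2.2)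

lemma lcone_open (f : (Fin d → ℝ) →ₗ[ℝ] ℝ) {A : Set (PSpace d)} (hA : IsOpen A) :
    IsOpen (lcone f A) := by
  have hf : Continuous f := f.continuous_of_finiteDimensional
  have h1 : IsOpen ((fun v : {v : Fin d → ℝ // v ≠ 0} =>
      (Projectivization.mk ℝ v.1 v.2 : PSpace d)) ⁻¹' A) := hA.preimage continuous_pmk
  have h2 : IsOpen {v : Fin d → ℝ | v ≠ 0} := isOpen_ne
  have h4 : IsOpen {v : Fin d → ℝ | 0 < f v} := isOpen_lt continuous_const hf
  have h3 := (h2.isOpenMap_subtype_val _ h1).inter h4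
  convert h3 using 1
  ext v
  simp only [lcone, mem_ofPred_eq, mem_inter_iff, mem_image, mem_preimage, Subtype.exists,
    exists_and_right, exists_eq_right]
  tauto

lemma chartMap_continuousAt (f : (Fin d → ℝ) →ₗ[ℝ] ℝ) {x : PSpace d} (hx : f x.rep ≠ 0) :
    ContinuousAt (chartMap f) x := by
  have hf : Continuous f := f.continuous_of_finiteDimensional
  rw [ContinuousAt, tendsto_def]
  intro s hs
  have hc : ContinuousAt (fun v : Fin d → ℝ => (f v)⁻¹ • v) (chartMap f x) := by
    refine ContinuousAt.smul (hf.continuousAt.inv₀ ?_) continuousAt_id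
    rw [f_chartMap f hx]; exact one_ne_zero
  have e : (f (chartMap f x))⁻¹ • chartMap f x = chartMap f x := by
    rw [f_chartMap f hx]; simp
  have hs' : (fun v : Fin d → ℝ => (f v)⁻¹ • v) ⁻¹' s ∈ nhds (chartMap f x) := by
    apply hc
    change s ∈ nhds ((f (chartMap f x))⁻¹ • chartMap f x)
    rw [e]; exact hs
  obtain ⟨N, hNs, hN, hxN⟩ := mem_nhds_iff.1 hs'
  have hn := pmk_nhds (chartMap_ne f hx) hN hxN
  rw [mk_chartMap f hx] at hn
  filter_upwards [hn]
  rintro y ⟨w, hw, hw0, rfl⟩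
  rw [mem_preimage, chartMap_mk f hw0]
  exact hNs hw

lemma lcone_OCone (f : (Fin d → ℝ) →ₗ[ℝ] ℝ) {A : Set (PSpace d)} (hne : A.Nonempty)
    (hf : ∀ x ∈ A, f x.rep ≠ 0) (hc : Convex ℝ (chartMap f '' A))
    (hb : Bornology.IsBounded (chartMap f '' A)) : OCone f (lcone f A) := by
  have key : ∀ v, v ∈ lcone f A ↔ 0 < f v ∧ (f v)⁻¹ • v ∈ chartMap f '' A := by
    intro v
    constructor
    · rintro ⟨h1, h2, h3⟩
      exact ⟨h1, _, h3, chartMap_mk f h2⟩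
    · rintro ⟨h1, x, hx, h2⟩
      have h0 : v ≠ 0 := by rintro rfl; simp at h1
      refine ⟨h1, h0, ?_⟩
      have : Projectivization.mk ℝ v h0 = x := by
        rw [← mk_chartMap f (hf x hx) (chartMap_ne f (hf x hx)), pmk_eq_iff]
        refine ⟨f v, h1.ne', ?_⟩
        rw [h2, smul_smul, mul_inv_cancel₀ h1.ne', one_smul]
      rwa [this]
  refine ⟨?_, ?_, ?_, ?_, ?_⟩
  · intro u hu v hv
    rw [key] at hu hv ⊢
    have hp : 0 < f u + f v := add_pos hu.1 hv.1
    refine ⟨by simpa using hp, ?_⟩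
    have := hc hu.2 hv.2 (a := f u / (f u + f v)) (b := f v / (f u + f v))
      (div_nonneg hu.1.le hp.le) (div_nonneg hv.1.le hp.le) (by field_simp)
    convert this using 1
    rw [smul_smul, smul_smul, map_add, smul_add]
    have := hu.1.ne'
    have := hv.1.ne'
    congr 2 <;> field_simp
  · rintro c hc u ⟨h1, h2, h3⟩
    exact ⟨by simpa using mul_pos hc h1, smul_ne_zero hc.ne' h2, by rwa [pmk_smul h2 hc.ne']⟩
  · obtain ⟨M, hM⟩ := hb.exists_norm_le
    refine ⟨max M 1, by positivity, ?_⟩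
    intro u hu
    rw [key] at hu
    have := hM _ hu.2
    rw [norm_smul, norm_inv, Real.norm_eq_abs, abs_of_pos hu.1, inv_mul_le_iff₀ hu.1] at this
    calc ‖u‖ ≤ f u * M := this
      _ ≤ f u * max M 1 := by gcongr; exacts [hu.1.le, le_max_left _ _]
      _ = _ := mul_comm _ _
  · obtain ⟨x, hx⟩ := hne
    exact ⟨_, (chartMap_mem_lcone f (hf x hx)).2 hx⟩
  · intro u hu; exact hu.1

lemma mem_openSeg_aux (f : (Fin d → ℝ) →ₗ[ℝ] ℝ) {A B X : Fin d → ℝ} {c c' : ℝ} (hc : 0 < c)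
    (hc' : 0 < c') (hA : 0 < f A) (hB : 0 < f B) (hX : X = c • A + c' • B) (hX1 : f X = 1) :
    X ∈ openSegment ℝ ((f A)⁻¹ • A) ((f B)⁻¹ • B) := by
  refine ⟨c * f A, c' * f B, by positivity, by positivity, ?_, ?_⟩
  · rw [hX] at hX1; simpa using hX1
  · rw [smul_smul, smul_smul, mul_assoc, mul_assoc, mul_inv_cancel₀ hA.ne',
      mul_inv_cancel₀ hB.ne', hX]
    simp

section face
variable {f : (Fin d → ℝ) →ₗ[ℝ] ℝ} {Ω : Set (PSpace d)}

lemma face_DRel (hfΩ : cmap Ω = chartMap f) (h : OCone f (lcone f Ω))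
    (hf : ∀ x ∈ closure Ω, f x.rep ≠ 0) {x y : PSpace d} (hx : x ∈ closure Ω)
    (hy : y ∈ face Ω x) : y ∈ closure Ω ∧
      ∃ L, DRel (closure (lcone f Ω)) L (chartMap f x) (chartMap f y) := by
  rcases hy with rfl | ⟨hy, a, ha, b, hb, ⟨-, hxs⟩, ⟨-, hys⟩⟩
  · exact ⟨hx, 1, h.DRel_refl le_rfl _⟩
  refine ⟨hy, ?_⟩
  rw [hfΩ] at hxs hys
  have ha' := chartMap_mem_closure f (hf a ha) ha
  have hb' := chartMap_mem_closure f (hf b hb) hb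
  obtain ⟨s, r, hs, hr, -, ex⟩ := hxs
  obtain ⟨s', r', hs', hr', -, ey⟩ := hys
  rw [← ex, ← ey]
  have key : ∀ s r s' r' : ℝ, 0 < s → 0 < r → 0 < s' → 0 < r' → 
      (s / s' + r / r') • (s' • chartMap f a + r' • chartMap f b) -
        (s • chartMap f a + r • chartMap f b) ∈ closure (lcone f Ω) := by
    intro s r s' r' hs hr hs' hr'
    have := h.cl_add (h.cl_smul (c := r / r' * s') (by positivity) ha')
      (h.cl_smul (c := s / s' * r') (by positivity) hb')
    convert this using 1
    have e1 : s / s' * s' = s := by field_simp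
    have e2 : r / r' * r' = r := by field_simp
    rw [smul_add, smul_smul, smul_smul, add_mul, add_mul, e1, e2]
    module
  exact ⟨_, s / s' + r / r', s' / s + r' / r, by positivity, by positivity, le_rfl,
    key s r s' r' hs hr hs' hr', key s' r' s r hs' hr' hs hr⟩

lemma mem_face_of_DRel (hfΩ : cmap Ω = chartMap f) (h : OCone f (lcone f Ω))
    (hf : ∀ x ∈ closure Ω, f x.rep ≠ 0) {x : PSpace d} (hx : x ∈ closure Ω)
    {w : Fin d → ℝ} (hw : w ∈ closure (lcone f Ω)) (hw0 : w ≠ 0) {L : ℝ}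
    (hD : DRel (closure (lcone f Ω)) L (chartMap f x) w) :
    Projectivization.mk ℝ w hw0 ∈ face Ω x := by
  obtain ⟨a, b, ha, hb, -, h1, h2⟩ := hD
  have hxK := chartMap_mem_closure f (hf x hx) hx
  have hx1 := f_chartMap f (hf x hx)
  have hfw := h.cl_pos hw hw0
  set X := chartMap f x with hX
  set A := (a • w - X) + w with hA
  set B := (b • X - w) + X with hB
  have hAK : A ∈ closure (lcone f Ω) := h.cl_add h1 hw
  have hBK : B ∈ closure (lcone f Ω) := h.cl_add h2 hxK
  have hfA : 0 < f A := by
    rw [hA, map_add]; have := h.cl_nonneg h1; linarith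
  have hfB : 0 < f B := by
    rw [hB, map_add]; have := h.cl_nonneg h2; linarith
  have hA0 : A ≠ 0 := by intro h0; rw [h0] at hfA; simp at hfA
  have hB0 : B ≠ 0 := by intro h0; rw [h0] at hfB; simp at hfB
  have hDp : 0 < (a + 1) * (b + 1) - 1 := by nlinarith
  set D := (a + 1) * (b + 1) - 1 with hDd
  have eX : X = D⁻¹ • A + (D⁻¹ * (a + 1)) • B := by
    have e : D • X = A + (a + 1) • B := by rw [hA, hB, hDd]; module
    have e2 : X = D⁻¹ • (D • X) := by rw [smul_smul, inv_mul_cancel₀ hDp.ne', one_smul]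
    rw [e2, e]; module
  have ew : (f w)⁻¹ • w = ((f w)⁻¹ * (D⁻¹ * (b + 1))) • A + ((f w)⁻¹ * D⁻¹) • B := by
    have e : D • w = (b + 1) • A + B := by rw [hA, hB, hDd]; module
    have e2 : w = D⁻¹ • (D • w) := by rw [smul_smul, inv_mul_cancel₀ hDp.ne', one_smul]
    rw [e] at e2
    refine (congrArg (fun t => (f w)⁻¹ • t) e2).trans ?_
    module
  have hwc := mk_mem_closure f hw0 hw
  refine Or.inr ⟨hwc, _, mk_mem_closure f hA0 hAK, _, mk_mem_closure f hB0 hBK, ⟨hx, ?_⟩, ⟨hwc, ?_⟩⟩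
  · rw [hfΩ, chartMap_mk, chartMap_mk]
    exact mem_openSeg_aux f (by positivity) (by positivity) hfA hfB eX hx1
  · rw [hfΩ, chartMap_mk, chartMap_mk, chartMap_mk]
    refine mem_openSeg_aux f (by positivity) (by positivity) hfA hfB ew ?_
    rw [map_smul, smul_eq_mul, inv_mul_cancel₀ hfw.ne']

end face

section half
variable {E : Type*} [NormedAddCommGroup E] [NormedSpace ℝ E] [FiniteDimensional ℝ E]
  {f : E →ₗ[ℝ] ℝ} {U : Set E}

lemma OCone.ext_mem (h : OCone f U) {y z : E} (hy : y ∈ closure U) (hz : z ∈ closure U)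
    (hz0 : 0 < f z) {a s : ℝ} (ha : 0 < a) (h1 : a • z - y ∈ closure U) (hs : 0 ≤ s) (hs1 : s < 1) :
    a • z - s • y ∈ closure U ∧ 0 < f (a • z - s • y) ∧
      ∃ L, DRel (closure U) L z (a • z - s • y) := by
  have hs' : 0 < 1 - s := by linarith
  have e : a • z - s • y = ((1 - s) * a) • z + s • (a • z - y) := by module
  refine ⟨?_, ?_, _, ((1 - s) * a)⁻¹, a, by positivity, ha, le_rfl, ?_, ?_⟩
  · rw [e]; exact h.cl_add (h.cl_smul (by positivity) hz) (h.cl_smul hs h1)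
  · rw [e, map_add, map_smul, map_smul, smul_eq_mul, smul_eq_mul]
    have := h.cl_nonneg h1
    positivity
  · have := h.cl_smul (c := ((1 - s) * a)⁻¹ * s) (by positivity) h1
    convert this using 1
    rw [e, smul_add, smul_smul, inv_mul_cancel₀ (by positivity), one_smul, add_sub_cancel_left,
      smul_smul]
  · have := h.cl_smul hs hy
    convert this using 1
    module

lemma OCone.half (h : OCone f U) {f' : E →ₗ[ℝ] ℝ} {y z : E}
    (hP : ∀ w ∈ closure U, 0 < f w → (∃ L, DRel (closure U) L y w) → f' w ≠ 0)
    (hy : y ∈ closure U) (hz : z ∈ closure U) (hy0 : 0 < f y) (hz0 : 0 < f z) {m : ℝ} (hm : 0 < m)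
    (hD : DRel (closure U) m y z) :
    ∃ k : ℝ, ∃ w ∈ closure U, 0 < f w ∧ (∃ L, DRel (closure U) L y w) ∧
      (1 + 1 / m) • ((f' z)⁻¹ • z) - (1 / m) • ((f' y)⁻¹ • y) = k • w ∧ k * f' w = 1 := by
  have hD' := hD
  obtain ⟨a, b, ha, hb, hab, h1, h2⟩ := hD
  have hA : f' y ≠ 0 := hP y hy hy0 ⟨1, h.DRel_refl le_rfl y⟩
  have hB : f' z ≠ 0 := hP z hz hz0 ⟨m, hD'⟩
  have hsum : ∀ s : ℝ, 0 ≤ s → f' y + s * f' z ≠ 0 := by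
    intro s hs
    have := hP (y + s • z) (h.cl_add hy (h.cl_smul hs hz))
      (by rw [map_add, map_smul, smul_eq_mul]; positivity)
      ⟨_, 1, 1 + s * b, one_pos, by positivity, le_rfl, by simpa using h.cl_smul hs hz, by
        have := h.cl_smul hs h2
        convert this using 1
        module⟩
    simpa using this
  have hpos : 0 < f' z / f' y := by
    by_contra hcon
    push Not at hcon
    have h3 : f' y / f' z ≤ 0 := by
      rw [← inv_div]; exact inv_nonpos.2 hcon
    apply hsum (-(f' y / f' z)) (by linarith)
    field_simp
    simp
  have hle : f' z / f' y ≤ b := by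
    by_contra hcon
    push Not at hcon
    set ρ := f' z / f' y with hρ
    have e : f' z = ρ * f' y := by rw [hρ]; field_simp
    obtain ⟨q1, q2, L, q3⟩ := h.ext_mem hz hy hy0 hb h2 (s := b / ρ) (by positivity)
      ((div_lt_one hpos).2 hcon)
    apply hP _ q1 q2 ⟨L, q3⟩
    rw [map_sub, map_smul, map_smul, smul_eq_mul, smul_eq_mul, e]
    field_simp
    simp
  set ρ := f' z / f' y with hρ
  have e : f' z = ρ * f' y := by rw [hρ]; field_simp
  have hs1 : 1 / m * ρ * a / (1 + 1 / m) < 1 := by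
    rw [div_lt_one (by positivity)]
    have : 1 / m * ρ * a ≤ 1 := by
      calc 1 / m * ρ * a ≤ 1 / m * b * a := by gcongr
        _ = (a * b) / m := by ring
        _ ≤ 1 := (div_le_one hm).2 hab
    have : 0 < 1 / m := by positivity
    linarith
  obtain ⟨q1, q2, L, q3⟩ := h.ext_mem hy hz hz0 ha h1 (s := 1 / m * ρ * a / (1 + 1 / m))
    (by positivity) hs1
  have hm1 : 1 + 1 / m ≠ 0 := by positivity
  refine ⟨(1 + 1 / m) / (a * f' z), _, q1, q2, ⟨_, h.DRel_trans hD' q3⟩, ?_, ?_⟩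
  · rw [smul_sub, smul_smul, smul_smul, smul_smul, smul_smul]
    have hρ0 := hpos.ne'
    congr 2
    · field_simp
    · rw [e]; field_simp
  · rw [map_sub, map_smul, map_smul, smul_eq_mul, smul_eq_mul, e]
    have hρ0 := hpos.ne'
    field_simp
    ring

end half

lemma hilbertDistChart_le {O : Set (Fin d → ℝ)} {u v : Fin d → ℝ} {m : ℝ} (hm : 0 < m)
    (hO : Bornology.IsBounded O) (h1 : u + (1 + 1 / m) • (v - u) ∈ O)
    (h2 : u + (-(1 / m)) • (v - u) ∈ O) : hilbertDistChart O u v ≤ Real.log (1 + m) := by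
  unfold hilbertDistChart
  split_ifs with huv
  · exact Real.log_nonneg (by linarith)
  obtain ⟨M, hM⟩ := hO.exists_norm_le
  have hvu : 0 < ‖v - u‖ := norm_pos_iff.2 (sub_ne_zero.2 (Ne.symm huv))
  have hbd : ∀ t ∈ {t : ℝ | u + t • (v - u) ∈ O}, |t| ≤ (M + ‖u‖) / ‖v - u‖ := by
    intro t ht
    rw [le_div_iff₀ hvu]
    have e : t • (v - u) = (u + t • (v - u)) - u := by abel
    calc |t| * ‖v - u‖ = ‖t • (v - u)‖ := by rw [norm_smul, Real.norm_eq_abs]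
      _ = ‖(u + t • (v - u)) - u‖ := by rw [← e]
      _ ≤ ‖u + t • (v - u)‖ + ‖u‖ := norm_sub_le _ _
      _ ≤ _ := by gcongr; exact hM _ ht
  have hba : BddAbove {t : ℝ | u + t • (v - u) ∈ O} := ⟨_, fun t ht => (abs_le.1 (hbd t ht)).2⟩
  have hbb : BddBelow {t : ℝ | u + t • (v - u) ∈ O} := ⟨_, fun t ht => (abs_le.1 (hbd t ht)).1⟩
  have hS := le_csSup hba h1
  have hI := csInf_le hbb h2
  set S := sSup {t : ℝ | u + t • (v - u) ∈ O}
  set I := sInf {t : ℝ | u + t • (v - u) ∈ O}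
  have hm' : 0 < 1 / m := by positivity
  have k1 : S ≤ (1 + m) * (S - 1) := by
    have : m * (1 / m) = 1 := by field_simp
    nlinarith
  have k2 : 1 - I ≤ (1 + m) * (-I) := by
    have : m * (1 / m) = 1 := by field_simp
    nlinarith
  have p1 : 0 < S - 1 := by linarith
  have p2 : 0 < -I := by linarith
  have hX : S * (1 - I) / (-I * (S - 1)) ≤ (1 + m) ^ 2 := by
    rw [div_le_iff₀ (by positivity)]
    calc S * (1 - I) ≤ ((1 + m) * (S - 1)) * ((1 + m) * (-I)) :=
          mul_le_mul k1 k2 (by linarith) (by positivity)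
      _ = _ := by ring
  have hX0 : 0 < S * (1 - I) / (-I * (S - 1)) :=
    div_pos (mul_pos (by linarith) (by linarith)) (by positivity)
  have := Real.log_le_log hX0 hX
  rw [Real.log_pow] at this
  push_cast at this
  linarith

lemma chartOf_spec {A : Set (PSpace d)} (h : IsProperlyConvex A) :
    (∀ x ∈ closure A, chartOf A x.rep ≠ 0) ∧
    Convex ℝ (chartMap (chartOf A) '' A) ∧ Bornology.IsBounded (chartMap (chartOf A) '' A) := by
  unfold chartOf
  rw [dif_pos h]
  exact h.choose_spec

lemma hilbert_bound {f : (Fin d → ℝ) →ₗ[ℝ] ℝ} {Ω : Set (PSpace d)}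
    (hfΩ : cmap Ω = chartMap f) (h : OCone f (lcone f Ω))
    (hf : ∀ x ∈ closure Ω, f x.rep ≠ 0) {x y z : PSpace d} (hx : x ∈ closure Ω)
    (hy : y ∈ face Ω x) (hz : z ∈ face Ω x) {m : ℝ} (hm : 0 < m)
    (hD : DRel (closure (lcone f Ω)) m (chartMap f y) (chartMap f z)) :
    hilbertDist (face Ω x) y z ≤ Real.log (1 + m) := by
  by_cases hpc : IsProperlyConvex (face Ω x)
  swap
  · have : hilbertDist (face Ω x) y z = 0 := by
      simp [hilbertDist, hilbertDistChart, cmap, chartMap, chartOf, dif_neg hpc]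
    rw [this]
    exact Real.log_nonneg (by linarith)
  obtain ⟨g1, -, g3⟩ := chartOf_spec hpc
  obtain ⟨hyc, L1, hyD⟩ := face_DRel hfΩ h hf hx hy
  obtain ⟨hzc, L2, hzD⟩ := face_DRel hfΩ h hf hx hz
  set f' := chartOf (face Ω x) with hf'
  have hyK := chartMap_mem_closure f (hf y hyc) hyc
  have hzK := chartMap_mem_closure f (hf z hzc) hzc
  have hy1 := f_chartMap f (hf y hyc)
  have hz1 := f_chartMap f (hf z hzc)
  have mem : ∀ (t : PSpace d) (L : ℝ), DRel (closure (lcone f Ω)) L (chartMap f x) (chartMap f t) →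
      ∀ w ∈ closure (lcone f Ω), ∀ hw0 : w ≠ 0,
      (∃ L, DRel (closure (lcone f Ω)) L (chartMap f t) w) →
      Projectivization.mk ℝ w hw0 ∈ face Ω x := by
    rintro t L ht w hw hw0 ⟨L', hL'⟩
    exact mem_face_of_DRel hfΩ h hf hx hw hw0 (h.DRel_trans ht hL')
  have hne : ∀ w : Fin d → ℝ, 0 < f w → w ≠ 0 := by
    rintro w hw rfl
    simp at hw
  have nz : ∀ (t : PSpace d) (L : ℝ), DRel (closure (lcone f Ω)) L (chartMap f x) (chartMap f t) →
      ∀ w ∈ closure (lcone f Ω), 0 < f w →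
      (∃ L, DRel (closure (lcone f Ω)) L (chartMap f t) w) → f' w ≠ 0 := by
    intro t L ht w hw hw0 hL
    have := g1 _ (subset_closure (mem t L ht w hw (hne w hw0) hL))
    rwa [f_rep_ne] at this
  have ey : cmap (face Ω x) y = (f' (chartMap f y))⁻¹ • chartMap f y := by
    rw [← chartMap_mk f' (chartMap_ne f (hf y hyc)), mk_chartMap f (hf y hyc)]; rfl
  have ez : cmap (face Ω x) z = (f' (chartMap f z))⁻¹ • chartMap f z := by
    rw [← chartMap_mk f' (chartMap_ne f (hf z hzc)), mk_chartMap f (hf z hzc)]; rfl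
  have memO : ∀ (t : PSpace d) (L : ℝ),
      DRel (closure (lcone f Ω)) L (chartMap f x) (chartMap f t) → ∀ X : Fin d → ℝ,
      (∃ k : ℝ, ∃ w ∈ closure (lcone f Ω), 0 < f w ∧
        (∃ L, DRel (closure (lcone f Ω)) L (chartMap f t) w) ∧ X = k • w ∧ k * f' w = 1) →
      X ∈ cmap (face Ω x) '' face Ω x := by
    rintro t L ht X ⟨k, w, hw, hw0, hL, rfl, hk⟩
    refine ⟨_, mem t L ht w hw (hne w hw0) hL, ?_⟩
    change chartMap f' _ = _
    rw [chartMap_mk, ← eq_inv_of_mul_eq_one_left hk]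
  unfold hilbertDist
  refine hilbertDistChart_le hm g3 ?_ ?_
  · refine memO y L1 hyD _ ?_
    have := h.half (nz y L1 hyD) hyK hzK (by linarith) (by linarith) hm hD
    rw [show cmap (face Ω x) y + (1 + 1 / m) • (cmap (face Ω x) z - cmap (face Ω x) y) =
      (1 + 1 / m) • ((f' (chartMap f z))⁻¹ • chartMap f z) -
        (1 / m) • ((f' (chartMap f y))⁻¹ • chartMap f y) by rw [ey, ez]; module]
    exact this
  · refine memO z L2 hzD _ ?_
    have := h.half (nz z L2 hzD) hzK hyK (by linarith) (by linarith) hm hD.symm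
    rw [show cmap (face Ω x) y + (-(1 / m)) • (cmap (face Ω x) z - cmap (face Ω x) y) =
      (1 + 1 / m) • ((f' (chartMap f y))⁻¹ • chartMap f y) -
        (1 / m) • ((f' (chartMap f z))⁻¹ • chartMap f z) by rw [ey, ez]; module]
    exact this

lemma pact_mk (g : (Fin d → ℝ) ≃ₗ[ℝ] (Fin d → ℝ)) {v : Fin d → ℝ} (hv : v ≠ 0) (hg : g v ≠ 0) :
    pact g (Projectivization.mk ℝ v hv) = Projectivization.mk ℝ (g v) hg := by
  unfold pact
  rw [Projectivization.map_mk]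
  rfl

lemma pact_injective (g : (Fin d → ℝ) ≃ₗ[ℝ] (Fin d → ℝ)) : Function.Injective (pact g) :=
  Projectivization.map_injective _ _

lemma equiv_ne (g : (Fin d → ℝ) ≃ₗ[ℝ] (Fin d → ℝ)) {v : Fin d → ℝ} (hv : v ≠ 0) : g v ≠ 0 := by
  simpa using hv

lemma exists_lift {f : (Fin d → ℝ) →ₗ[ℝ] ℝ} {Ω : Set (PSpace d)} (h : OCone f (lcone f Ω))
    (hf : ∀ x ∈ Ω, f x.rep ≠ 0) (g : (Fin d → ℝ) ≃ₗ[ℝ] (Fin d → ℝ)) (hg : pact g '' Ω = Ω) :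
    ∃ g' : (Fin d → ℝ) ≃ₗ[ℝ] (Fin d → ℝ), (∀ v, g' v ∈ lcone f Ω ↔ v ∈ lcone f Ω) ∧
      (∀ (v : Fin d → ℝ) (hv : v ≠ 0) (hv' : g' v ≠ 0),
        Projectivization.mk ℝ (g' v) hv' = pact g (Projectivization.mk ℝ v hv)) ∧
      ∀ A ⊆ Ω, pact g '' A = A → ∀ v, g' v ∈ lcone f A ↔ v ∈ lcone f A := by
  have memΩ : ∀ A : Set (PSpace d), pact g '' A = A → ∀ x, pact g x ∈ A ↔ x ∈ A := by
    intro A hA x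
    conv_lhs => rw [← hA]
    exact (pact_injective g).mem_set_image
  obtain ⟨u, hu⟩ := h.ne
  have nz : ∀ v ∈ lcone f Ω, f (g v) ≠ 0 := by
    rintro v ⟨h1, h2, h3⟩
    rw [← memΩ Ω hg, pact_mk g h2 (equiv_ne g h2)] at h3
    exact (f_rep_ne f _).1 (hf _ h3)
  obtain ⟨g', hmk, hpos, hnz⟩ : ∃ g' : (Fin d → ℝ) ≃ₗ[ℝ] (Fin d → ℝ),
      (∀ (v : Fin d → ℝ) (hv : v ≠ 0) (hv' : g' v ≠ 0),
        Projectivization.mk ℝ (g' v) hv' = pact g (Projectivization.mk ℝ v hv)) ∧ 0 < f (g' u) ∧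
        ∀ v ∈ lcone f Ω, f (g' v) ≠ 0 := by
    rcases lt_or_gt_of_ne (nz u hu) with hlt | hgt
    · refine ⟨g.trans (LinearEquiv.neg ℝ), ?_, ?_, ?_⟩
      · intro v hv hv'
        rw [pact_mk g hv (equiv_ne g hv), pmk_eq_iff]
        exact ⟨-1, by norm_num, by simp⟩
      · simpa using hlt
      · intro v hv; simpa using nz v hv
    · exact ⟨g, fun v hv hv' => (pact_mk g hv hv').symm, hgt, nz⟩
  have hp : ∀ v ∈ lcone f Ω, 0 < f (g' v) := by
    intro v hv
    by_contra hcon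
    have hlt : f (g' v) < 0 := lt_of_le_of_ne (not_lt.1 hcon) (hnz v hv)
    apply hnz _ (h.add _ (h.smul (-f (g' v)) (by linarith) u hu) _ (h.smul (f (g' u)) hpos v hv))
    simp
    ring
  have fwd : ∀ A ⊆ Ω, pact g '' A = A → ∀ v, v ∈ lcone f A → g' v ∈ lcone f A := by
    rintro A hAΩ hA v ⟨h1, h2, h3⟩
    refine ⟨hp v ⟨h1, h2, hAΩ h3⟩, equiv_ne g' h2, ?_⟩
    rw [hmk v h2, memΩ A hA]
    exact h3
  have bwdΩ : ∀ v, g' v ∈ lcone f Ω → v ∈ lcone f Ω := by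
    rintro v ⟨h1, h2, h3⟩
    have hv : v ≠ 0 := by rintro rfl; simp at h2
    have h4 : Projectivization.mk ℝ v hv ∈ Ω := by
      rw [hmk v hv, memΩ Ω hg] at h3; exact h3
    have h5 := (f_rep_ne f hv).1 (hf _ h4)
    rcases lt_or_gt_of_ne h5 with hlt | hgt
    · exfalso
      have h6 : -v ∈ lcone f Ω := by
        refine ⟨by simpa using hlt, by simpa using hv, ?_⟩
        have : (Projectivization.mk ℝ (-v) (by simpa using hv) : PSpace d) =
            Projectivization.mk ℝ v hv := by
          rw [pmk_eq_iff]; exact ⟨-1, by norm_num, by simp⟩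
        rw [this]; exact h4
      have := hp _ h6
      simp at this
      linarith
    · exact ⟨hgt, hv, h4⟩
  refine ⟨g', fun v => ⟨bwdΩ v, fwd Ω le_rfl hg v⟩, hmk, ?_⟩
  intro A hAΩ hA v
  refine ⟨?_, fwd A hAΩ hA v⟩
  rintro ⟨h1, h2, h3⟩
  have hv : v ≠ 0 := by rintro rfl; simp at h2
  have h4 : Projectivization.mk ℝ v hv ∈ A := by
    rw [hmk v hv, memΩ A hA] at h3; exact h3
  have h5 : g' v ∈ lcone f Ω := ⟨h1, h2, hAΩ h3⟩
  exact ⟨(bwdΩ v h5).1, hv, h4⟩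

lemma exists_basis_map {v : Fin 3 → Fin d → ℝ} (hv : LinearIndependent ℝ v) :
    3 ≤ d ∧ ∃ g : (Fin d → ℝ) ≃ₗ[ℝ] (Fin d → ℝ), ∀ x : Fin d → ℝ,
      (∀ i : Fin d, 3 ≤ (i : ℕ) → x i = 0) →
      ∀ w : Fin 3 → ℝ, (∀ (i : Fin d) (hi : (i : ℕ) < 3), x i = w ⟨i, hi⟩) →
        g x = ∑ i, w i • v i := by
  have hd : 3 ≤ d := by simpa using hv.fintype_card_le_finrank
  refine ⟨hd, ?_⟩
  let b := Module.Basis.sumExtend hv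
  have : Finite (Fin 3 ⊕ Module.Basis.sumExtendIndex hv) := Module.Finite.finite_basis b
  have : Finite (Module.Basis.sumExtendIndex hv) := Finite.sum_right (Fin 3)
  have : Fintype (Module.Basis.sumExtendIndex hv) := Fintype.ofFinite _
  have hcard : Fintype.card (Module.Basis.sumExtendIndex hv) = d - 3 := by
    have h0 := Module.finrank_eq_card_basis b
    rw [Module.finrank_fin_fun, Fintype.card_sum, Fintype.card_fin] at h0
    omega
  let e : Fin 3 ⊕ Module.Basis.sumExtendIndex hv ≃ Fin d :=
    ((Equiv.refl _).sumCongr (Fintype.equivFinOfCardEq hcard)).trans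
      (finSumFinEquiv.trans (finCongr (by omega)))
  have he : ∀ i : Fin 3, (e (Sum.inl i) : ℕ) = i := by
    intro i; simp [e]
  have he' : ∀ j, 3 ≤ (e (Sum.inr j) : ℕ) := by
    intro j; simp [e]
  refine ⟨(b.reindex e).equivFun.symm, ?_⟩
  intro x hx w hw
  rw [Module.Basis.equivFun_symm_apply, ← e.sum_comp, Fintype.sum_sum_type]
  have h2 : ∑ j, x (e (Sum.inr j)) • (b.reindex e) (e (Sum.inr j)) = 0 :=
    Finset.sum_eq_zero fun j _ => by rw [hx _ (he' j), zero_smul]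
  rw [h2, add_zero]
  refine Finset.sum_congr rfl fun i _ => ?_
  have h3 : x (e (Sum.inl i)) = w i := by
    rw [hw _ (by rw [he]; exact i.2)]
    exact congrArg w (Fin.ext (he i))
  rw [h3]
  congr 1
  simp only [b, Module.Basis.sumExtend, Module.Basis.reindex_apply, Equiv.symm_apply_apply]
  rw [Module.Basis.extend_apply_self]
  rfl


end proj

/-- Lemma 5.2: if the face diameters of the ideal boundary of a naive convex
co-compact triple are unbounded, then `C` contains a properly embedded two-dimensional
simplex. -/
theorem unbounded_face_diameters_give_simplex {d : ℕ} (T : NCCTriple d)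
    (h : ∀ R : ℝ, ∃ x ∈ idealBdry T.C, ∃ y ∈ idealBdry T.C ∩ face T.Ω x,
      ∃ z ∈ idealBdry T.C ∩ face T.Ω x, R < hilbertDist (face T.Ω x) y z) :
    ∃ S : Set (PSpace d), IsSimplexOfDim 2 S ∧ S ⊆ T.C ∧ IsProperlyEmbedded S T.C := by
  obtain ⟨hf, hcv, hbd⟩ := chartOf_spec T.properlyConvex_Ω
  have hfΩ : cmap T.Ω = chartMap (chartOf T.Ω) := rfl
  have hCcv := T.C_convex
  rw [hfΩ] at hCcv
  generalize chartOf T.Ω = f at hf hcv hbd hfΩ hCcv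
  have hfO : ∀ x ∈ T.Ω, f x.rep ≠ 0 := fun x hx => hf x (subset_closure hx)
  have hfC : ∀ x ∈ T.C, f x.rep ≠ 0 := fun x hx => hfO x (T.C_sub hx)
  have hU : OCone f (lcone f T.Ω) := lcone_OCone f T.nonempty_Ω hfO hcv hbd
  have hV : OCone f (lcone f T.C) := lcone_OCone f T.C_nonempty hfC hCcv
    (hbd.subset (image_mono T.C_sub))
  have ho : IsOpen (lcone f T.Ω) := lcone_open f T.isOpen_Ω
  have hVU : lcone f T.C ⊆ lcone f T.Ω := fun v hv => ⟨hv.1, hv.2.1, T.C_sub hv.2.2⟩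
  have hcl : closure (lcone f T.C) ∩ lcone f T.Ω ⊆ lcone f T.C := by
    rintro v ⟨h1, h2, hv, h3⟩
    exact ⟨h2, hv, T.C_closedInΩ ⟨mk_mem_closure f hv h1, h3⟩⟩
  have hcC : closure T.C ⊆ closure T.Ω := closure_mono T.C_sub
  obtain ⟨K, hKC, hKc, hK⟩ := T.cocompact
  have hKc' : IsCompact (chartMap f '' K) := hKc.image_of_continuousOn
    fun x hx => (chartMap_continuousAt f (hfC x (hKC hx))).continuousWithinAt
  obtain ⟨v, hv, hv1, hw, hno⟩ := OCone.core hU ho hV hVU hcl hKc'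
    (by rintro _ ⟨x, hx, rfl⟩; exact (chartMap_mem_lcone f (hfC x (hKC hx))).2 (hKC hx))
    (by rintro _ ⟨x, hx, rfl⟩; exact f_chartMap f (hfC x (hKC hx)))
    (by
      intro q hq
      obtain ⟨hq0, hqne, hqC⟩ := hq
      have h1 := hK hqC
      simp only [mem_iUnion] at h1
      obtain ⟨g, hg, k, hk, hgk⟩ := h1
      have hgi : g⁻¹ ∈ T.Λ := T.Λ.inv_mem hg
      obtain ⟨g', a1, a2, a3⟩ := exists_lift hU hfO g⁻¹ (T.inv_Ω _ hgi)
      refine ⟨g', a1, a3 _ T.C_sub (T.inv_C _ hgi), ?_⟩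
      have hgq : g' q ∈ lcone f T.C := (a3 _ T.C_sub (T.inv_C _ hgi) q).2 ⟨hq0, hqne, hqC⟩
      have e1 : Projectivization.mk ℝ (g' q) (equiv_ne g' hqne) = k := by
        rw [a2 q hqne, ← hgk]
        induction k using Projectivization.ind with
        | h k hk0 =>
          rw [pact_mk g hk0 (equiv_ne g hk0), pact_mk _ _ (equiv_ne _ (equiv_ne g hk0))]
          congr 1
          exact g.symm_apply_apply k
      refine ⟨(f (g' q))⁻¹, inv_pos.2 hgq.1, k, hk, ?_⟩
      rw [← e1, chartMap_mk])
    (by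
      intro l hl
      obtain ⟨x, hx, y, ⟨hy, hyF⟩, z, ⟨hz, hzF⟩, hR⟩ := h (Real.log (1 + l * l))
      have hxc := hcC hx.1
      obtain ⟨hyc, L1, d1⟩ := face_DRel hfΩ hU hf hxc hyF
      obtain ⟨hzc, L2, d2⟩ := face_DRel hfΩ hU hf hxc hzF
      refine ⟨chartMap f y, chartMap f z, chartMap_mem_closure f (hf y hyc) hy.1,
        chartMap_mem_closure f (hf z hzc) hz.1, f_chartMap f (hf y hyc), f_chartMap f (hf z hzc),
        ?_, ⟨_, hU.DRel_trans d1.symm d2⟩, ?_⟩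
      · intro hyU
        exact hy.2 (T.C_closedInΩ ⟨hy.1, (chartMap_mem_lcone f (hf y hyc)).1 hyU⟩)
      · intro hD
        exact absurd (hilbert_bound hfΩ hU hf hxc hyF hzF (by positivity) hD) (not_le.2 hR))
  obtain ⟨hd, g, hg⟩ := exists_basis_map (linInd_of hv1 hw hno)
  obtain ⟨w, hw0, hwU⟩ := hw
  have hclU : closure (lcone f T.C) ⊆ closure (lcone f T.Ω) := closure_mono hVU
  have hpos : ∀ c : Fin 3 → ℝ, (∀ i, 0 < c i) → ∑ i, c i • v i ∈ lcone f T.C := by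
    intro c hc
    have hsum : ∀ c : Fin 3 → ℝ, (∀ i, 0 ≤ c i) → ∑ i, c i • v i ∈ closure (lcone f T.C) := by
      intro c hc
      rw [Fin.sum_univ_three]
      exact hV.cl_add (hV.cl_add (hV.cl_smul (hc 0) (hv 0)) (hV.cl_smul (hc 1) (hv 1)))
        (hV.cl_smul (hc 2) (hv 2))
    refine hcl ⟨hsum c fun i => (hc i).le, ?_⟩
    obtain ⟨ε, he, hle⟩ : ∃ ε : ℝ, 0 < ε ∧ ∀ i, 0 ≤ c i - ε * w i := by
      refine ⟨min (c 0) (min (c 1) (c 2)) / (1 + w 0 + w 1 + w 2), ?_, ?_⟩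
      · have := hw0 0
        have := hw0 1
        have := hw0 2
        have := hc 0
        have := hc 1
        have := hc 2
        positivity
      · intro i
        have q0 := hw0 0
        have q1 := hw0 1
        have q2 := hw0 2
        have hm : 0 < min (c 0) (min (c 1) (c 2)) := lt_min (hc 0) (lt_min (hc 1) (hc 2))
        have hmi : min (c 0) (min (c 1) (c 2)) ≤ c i := by
          fin_cases i <;> simp
        have hwi : w i ≤ 1 + w 0 + w 1 + w 2 := by
          fin_cases i <;> simp <;> linarith
        have hp : 0 < 1 + w 0 + w 1 + w 2 := by linarith
        rw [sub_nonneg, div_mul_eq_mul_div, div_le_iff₀ hp]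
        exact mul_le_mul hmi hwi (hw0 i) (hc i).le
    have e : ∑ i, c i • v i = ε • ∑ i, w i • v i + ∑ i, (c i - ε * w i) • v i := by
      rw [Finset.smul_sum, ← Finset.sum_add_distrib]
      refine Finset.sum_congr rfl fun i _ => ?_
      rw [smul_smul, ← add_smul]
      congr 1
      ring
    rw [e]
    exact hU.add_cl ho (hU.smul ε he _ hwU) (hclU (hsum _ hle))
  have hgx : ∀ x : Fin d → ℝ, (∀ i : Fin d, 3 ≤ (i : ℕ) → x i = 0) →
      g x = ∑ i, x (Fin.castLE hd i) • v i := by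
    intro x hx
    exact hg x hx (fun i => x (Fin.castLE hd i)) (fun i hi => rfl)
  have hgpos : ∀ x ∈ simplexCone (d := d) 3, g x ∈ lcone f T.C := by
    intro x hx
    rw [hgx x hx.2]
    exact hpos _ fun i => hx.1 _ i.2
  let S : Set (PSpace d) := {q : PSpace d | ∃ v ∈ simplexCone (d := d) (2 + 1), ∃ hv : v ≠ 0,
        q = Projectivization.mk ℝ (g v) (by simpa using hv)}
  have hSC : S ⊆ T.C := by
    rintro q ⟨x, hx, hx0, rfl⟩
    exact (hgpos x hx).2.2
  refine ⟨S, ⟨hd, g, rfl⟩, hSC, hSC, ?_⟩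
  have hcl2 : closure S ∩ T.C ⊆ S := by
    rintro c ⟨hcS, hcC⟩
    have h1 := chartMap_mem_closure f (hfC c hcC) hcS
    let P : Set (Fin d → ℝ) := {x | (∀ i : Fin d, (i : ℕ) < 3 → 0 ≤ x i) ∧
      ∀ i : Fin d, 3 ≤ (i : ℕ) → x i = 0}
    have hP : IsClosed P := by
      simp only [P, Set.ofPred_and, Set.ofPred_forall]
      refine IsClosed.inter ?_ ?_
      · exact isClosed_iInter fun i => isClosed_iInter fun _ =>
          isClosed_le continuous_const (continuous_apply i)
      · exact isClosed_iInter fun i => isClosed_iInter fun _ =>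
          isClosed_eq (continuous_apply i) continuous_const
    have hgc : Continuous g.symm := g.symm.toLinearMap.continuous_of_finiteDimensional
    have hsub : lcone f S ⊆ g.symm ⁻¹' P := by
      rintro u ⟨hu, hu0, x, hx, hx0, hux⟩
      obtain ⟨a, ha, rfl⟩ := (pmk_eq_iff hu0 _).1 hux
      have hfx := (hgpos x hx).1
      rw [map_smul, smul_eq_mul] at hu
      have ha : 0 < a := (mul_pos_iff_of_pos_right hfx).1 hu
      simp only [mem_preimage, map_smul, LinearEquiv.symm_apply_apply]
      refine ⟨fun i hi => ?_, fun i hi => ?_⟩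
      · exact mul_nonneg ha.le (hx.1 i hi).le
      · simp [hx.2 i hi]
    have h2 : g.symm (chartMap f c) ∈ P := closure_minimal hsub (hP.preimage hgc) h1
    have h3 : g (g.symm (chartMap f c)) = chartMap f c := g.apply_symm_apply _
    have hcU : chartMap f c ∈ lcone f T.Ω :=
      (chartMap_mem_lcone f (hfC c hcC)).2 (T.C_sub hcC)
    have hc0 : chartMap f c ≠ 0 := chartMap_ne f (hfC c hcC)
    generalize g.symm (chartMap f c) = x at h2 h3
    have hx0 : x ≠ 0 := by
      rintro rfl
      rw [map_zero] at h3
      exact hc0 h3.symm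
    refine ⟨x, ⟨fun i hi => ?_, h2.2⟩, hx0, ?_⟩
    · refine lt_of_le_of_ne (h2.1 i hi) fun h0 => ?_
      rw [← h3, hgx x h2.2] at hcU
      exact hno (fun j => x (Fin.castLE hd j)) (fun j => h2.1 _ j.2) ⟨⟨i, hi⟩, h0.symm⟩ hcU
    · rw [← mk_chartMap f (hfC c hcC) hc0]
      congr 1
      exact h3.symm
  refine Topology.IsClosedEmbedding.isProperMap ⟨Topology.IsEmbedding.inclusion hSC, ?_⟩
  rw [range_inclusion, isClosed_induced_iff]
  refine ⟨closure S, isClosed_closure, ?_⟩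
  ext c
  exact ⟨fun hc => hcl2 ⟨hc, c.2⟩, fun hc => subset_closure hc⟩

end Paper
end
end

section
/- Let (X, d) be a proper geodesic metric space and δ > 0. Suppose that for each pair (x, y) ∈ X × X there is a chosen geodesic σ_{x,y} : [0, d(x,y)] → X from x to y, such that for every three distinct points x, y, z ∈ X the geodesic triangle formed by σ_{x,y}, σ_{y,z}, σ_{z,x} is δ-thin (each side is contained in the δ-neighborhood of the union of the other two sides). Then (X, d) is Gromov hyperbolic. -/
open Set

/-- Proposition 5.3: a proper geodesic metric space admitting a choice of
geodesics `σ x y : [0, d(x,y)] → X` between every pair of points, all of whose geodesic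
triangles are `δ`-thin (each side lies in the `δ`-neighborhood of the union of the other
two sides), is Gromov hyperbolic. -/
theorem gromov_hyperbolic_of_thin_triangles {X : Type*} [MetricSpace X] [ProperSpace X]
    (σ : X → X → ℝ → X)
    (hσ : ∀ x y : X, σ x y 0 = x ∧ σ x y (dist x y) = y ∧
      ∀ s ∈ Icc (0 : ℝ) (dist x y), ∀ t ∈ Icc (0 : ℝ) (dist x y),
        dist (σ x y s) (σ x y t) = |s - t|)
    (δ : ℝ) (hδ : 0 < δ)
    (thin : ∀ x y z : X, x ≠ y → y ≠ z → z ≠ x →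
      (∀ s ∈ Icc (0 : ℝ) (dist x y),
        ∃ p ∈ σ y z '' Icc (0 : ℝ) (dist y z) ∪ σ z x '' Icc (0 : ℝ) (dist z x),
          dist (σ x y s) p ≤ δ) ∧
      (∀ s ∈ Icc (0 : ℝ) (dist y z),
        ∃ p ∈ σ x y '' Icc (0 : ℝ) (dist x y) ∪ σ z x '' Icc (0 : ℝ) (dist z x),
          dist (σ y z s) p ≤ δ) ∧
      (∀ s ∈ Icc (0 : ℝ) (dist z x),
        ∃ p ∈ σ x y '' Icc (0 : ℝ) (dist x y) ∪ σ y z '' Icc (0 : ℝ) (dist y z),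
          dist (σ z x s) p ≤ δ)) :
    ∃ δ' : ℝ, 0 ≤ δ' ∧ ∀ x y z w : X,
      min ((dist x w + dist y w - dist x y) / 2) ((dist y w + dist z w - dist y z) / 2) - δ' ≤
        (dist x w + dist z w - dist x z) / 2 := by
  -- a point on a chosen geodesic realizes equality in the triangle inequality
  have geo : ∀ x y : X, ∀ q ∈ σ x y '' Icc (0 : ℝ) (dist x y),
      dist x q + dist q y = dist x y := by
    rintro x y q ⟨s, hs, rfl⟩
    obtain ⟨h0, h1, h⟩ := hσ x y
    have a := h 0 ⟨le_rfl, dist_nonneg⟩ s hs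
    have b := h s hs (dist x y) ⟨dist_nonneg, le_rfl⟩
    rw [h0, zero_sub, abs_neg, abs_of_nonneg hs.1] at a
    rw [h1, abs_of_nonpos (by linarith [hs.2])] at b
    linarith
  have hl : ∀ x y : X, x ∈ σ x y '' Icc (0 : ℝ) (dist x y) := fun x y =>
    ⟨0, ⟨le_rfl, dist_nonneg⟩, (hσ x y).1⟩
  have hr : ∀ x y : X, y ∈ σ x y '' Icc (0 : ℝ) (dist x y) := fun x y =>
    ⟨dist x y, ⟨dist_nonneg, le_rfl⟩, (hσ x y).2.1⟩
  have conn : ∀ x y : X, IsPreconnected (σ x y '' Icc (0 : ℝ) (dist x y)) := by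
    intro x y
    refine isPreconnected_Icc.image _ ?_
    have : LipschitzOnWith 1 (σ x y) (Icc (0 : ℝ) (dist x y)) := by
      refine LipschitzOnWith.of_dist_le_mul ?_
      intro s hs t ht
      rw [(hσ x y).2.2 s hs t ht, Real.dist_eq]
      simp
    exact this.continuousOn
  refine ⟨5 * δ, by linarith, ?_⟩
  intro x y z w
  have key : (∃ p : X, dist w p - 4 * δ ≤ (dist x w + dist z w - dist x z) / 2 ∧
      ∃ q ∈ σ z y '' Icc (0 : ℝ) (dist z y) ∪ σ y x '' Icc (0 : ℝ) (dist y x),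
        dist p q ≤ δ) →
      min ((dist x w + dist y w - dist x y) / 2) ((dist y w + dist z w - dist y z) / 2) - 5 * δ ≤
        (dist x w + dist z w - dist x z) / 2 := by
    rintro ⟨p, hp, q, hq | hq, hpq⟩
    · have h1 := geo _ _ q hq
      have := min_le_right ((dist x w + dist y w - dist x y) / 2)
        ((dist y w + dist z w - dist y z) / 2)
      have := dist_triangle w p q
      have := dist_triangle y q w
      have := dist_triangle z q w
      simp only [dist_comm q y, dist_comm q w, dist_comm z y] at *
      linarith
    · have h1 := geo _ _ q hq
      have := min_le_left ((dist x w + dist y w - dist x y) / 2)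
        ((dist y w + dist z w - dist y z) / 2)
      have := dist_triangle w p q
      have := dist_triangle y q w
      have := dist_triangle x q w
      simp only [dist_comm q x, dist_comm q w, dist_comm y x] at *
      linarith
  have m1 := min_le_left ((dist x w + dist y w - dist x y) / 2)
        ((dist y w + dist z w - dist y z) / 2)
  have m2 := min_le_right ((dist x w + dist y w - dist x y) / 2)
        ((dist y w + dist z w - dist y z) / 2)
  by_cases hxz : x = z
  · subst hxz
    have := dist_triangle y x w
    rw [dist_comm y x] at this
    rw [dist_self]
    linarith
  by_cases hyx : y = x
  · subst hyx
    linarith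
  by_cases hzy : z = y
  · subst hzy
    linarith
  by_cases hwx : w = x
  · subst hwx
    have e1 := dist_self w
    have e2 := dist_comm y w
    have e3 := dist_comm z w
    linarith
  by_cases hzw : z = w
  · subst hzw
    have e1 := dist_self z
    linarith
  apply key
  have T := (thin x z w hxz hzw hwx).1
  have hcov : σ x z '' Icc (0 : ℝ) (dist x z) ⊆
      Metric.thickening (2 * δ) (σ z w '' Icc (0 : ℝ) (dist z w)) ∪
      Metric.thickening (2 * δ) (σ w x '' Icc (0 : ℝ) (dist w x)) := by
    rintro _ ⟨s, hs, rfl⟩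
    obtain ⟨p, hp | hp, hd⟩ := T s hs
    · exact Or.inl (Metric.mem_thickening_iff.2 ⟨p, hp, by linarith⟩)
    · exact Or.inr (Metric.mem_thickening_iff.2 ⟨p, hp, by linarith⟩)
  obtain ⟨_, ⟨s, hs, rfl⟩, hp1, hp2⟩ := conn x z _ _ Metric.isOpen_thickening
    Metric.isOpen_thickening hcov
    ⟨z, hr x z, Metric.mem_thickening_iff.2 ⟨z, hl z w, by rw [dist_self]; linarith⟩⟩
    ⟨x, hl x z, Metric.mem_thickening_iff.2 ⟨x, hr w x, by rw [dist_self]; linarith⟩⟩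
  obtain ⟨a, ha, hpa⟩ := Metric.mem_thickening_iff.1 hp1
  obtain ⟨b, hb, hpb⟩ := Metric.mem_thickening_iff.1 hp2
  refine ⟨σ x z s, ?_, (thin x z y hxz hzy hyx).1 s hs⟩
  have gp := geo x z _ ⟨s, hs, rfl⟩
  generalize σ x z s = p at *
  have ga := geo _ _ a ha
  have gb := geo _ _ b hb
  have t1 := dist_triangle w a p
  have t2 := dist_triangle z a p
  have t3 := dist_triangle w b p
  have t4 := dist_triangle x b p
  rw [dist_comm a p, dist_comm w a] at t1
  rw [dist_comm a p, dist_comm z p] at t2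
  rw [dist_comm b p] at t3
  rw [dist_comm b p, dist_comm x b] at t4
  rw [dist_comm w x] at gb
  linarith
end
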